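/- Let 𝒢 be a class of finite simple graphs having bounded tree depth, and let d ≥ 0. Then 𝒢 has stack depth d if and only if 𝒢 ≡ 𝒯_d or 𝒢 ≡ ℱ_d. -/

import Mathlib

open SimpleGraph

/-- The reflexive closure of the adjacency relation of a graph. -/
def reflAdj {α : Type} (G : SimpleGraph α) (a b : α) : Prop := a = b ∨ G.Adj a b

/-- A set of vertices induces a connected subgraph of `G`. -/
def ConnSet {α : Type} (G : SimpleGraph α) (s : Set α) : Prop := (G.induce s).Connected

/-- `B` is an `H`-deconstruction of `G`: coverage and connectivity. -/
def IsDeconstruction {α β : Type} (G : SimpleGraph α) (H : SimpleGraph β)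
    (B : β → Set α) : Prop :=
  (∀ g g' : α, reflAdj G g g' →
      ∃ h h' : β, reflAdj H h h' ∧ g ∈ B h ∪ B h' ∧ g' ∈ B h ∪ B h') ∧
  (∀ g : α, ConnSet H {h | g ∈ B h})

/-- The family `B` (viewed as an `H`-indexed family of bags) has width at most `w`. -/
def DeconWidthLE {α β : Type} (H : SimpleGraph β) (B : β → Set α) (w : ℕ) : Prop :=
  ∀ h h' : β, reflAdj H h h' → (B h ∪ B h').ncard ≤ w

/-- `B` is an `H`-decomposition of `G`: each (refl-)edge inside a single bag, plus
connectivity. -/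
def IsDecomposition {α β : Type} (G : SimpleGraph α) (H : SimpleGraph β)
    (B : β → Set α) : Prop :=
  (∀ g g' : α, reflAdj G g g' → ∃ h : β, g ∈ B h ∧ g' ∈ B h) ∧
  (∀ g : α, ConnSet H {h | g ∈ B h})

/-- A finite simple graph, presented on a vertex set `Fin n`. -/
structure FinGraph where
  n : ℕ
  G : SimpleGraph (Fin n)

/-- `𝒢 ≼ ℋ` : every graph in `𝒢` has an `H`-deconstruction of width `≤ w`
for some `H ∈ ℋ`, for a uniform constant `w`. -/
def DeconLE (𝒢 ℋ : Set FinGraph) : Prop :=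
  ∃ w : ℕ, ∀ G ∈ 𝒢, ∃ H ∈ ℋ, ∃ B : Fin H.n → Set (Fin G.n),
    IsDeconstruction G.G H.G B ∧ DeconWidthLE H.G B w

/-- `𝒢 ≡ ℋ`. -/
def DeconEquiv (𝒢 ℋ : Set FinGraph) : Prop := DeconLE 𝒢 ℋ ∧ DeconLE ℋ 𝒢

/-- `𝒢 ≺ ℋ`. -/
def DeconLT (𝒢 ℋ : Set FinGraph) : Prop := DeconLE 𝒢 ℋ ∧ ¬ DeconEquiv 𝒢 ℋ

/-- `μ` is a minor map from `M` to `G`. -/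
def IsMinorMap {α β : Type} (M : SimpleGraph α) (G : SimpleGraph β)
    (μ : α → Set β) : Prop :=
  (∀ m : α, ConnSet G (μ m)) ∧
  (∀ m m' : α, m ≠ m' → Disjoint (μ m) (μ m')) ∧
  (∀ m m' : α, M.Adj m m' → ∃ g ∈ μ m, ∃ g' ∈ μ m', G.Adj g g')

/-- `M` is a minor of `G`. -/
def IsMinor (M G : FinGraph) : Prop :=
  ∃ μ : Fin M.n → Set (Fin G.n), IsMinorMap M.G G.G μ

/-- The class of all minors of graphs in `𝒢`. -/
def minorsCl (𝒢 : Set FinGraph) : Set FinGraph := {M | ∃ G ∈ 𝒢, IsMinor M G}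

/-- The (connected) graph `G`, viewed as a tree, has height at most `d`:
some rooting puts every vertex within distance `d` of the root. -/
def treeHeightLE (G : FinGraph) (d : ℕ) : Prop :=
  ∃ r : Fin G.n, ∀ v : Fin G.n, G.G.dist r v ≤ d

/-- Every connected component of `G` has height at most `d`. -/
def forestHeightLE (G : FinGraph) (d : ℕ) : Prop :=
  ∀ v : Fin G.n, ∃ r : Fin G.n, G.G.Reachable r v ∧
    ∀ u : Fin G.n, G.G.Reachable r u → G.G.dist r u ≤ d

/-- `ℒ` : the class of all finite simple graphs. -/
def classL : Set FinGraph := Set.univ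

/-- `𝒯` : the class of all finite trees. -/
def classT : Set FinGraph := {G | G.G.IsTree}

/-- `𝒫` : the class of all finite paths (on at least two vertices). -/
def classP : Set FinGraph := {G | ∃ m : ℕ, 2 ≤ m ∧ Nonempty (G.G ≃g pathGraph m)}

/-- `𝒯_d` : all finite trees of height at most `d`. -/
def classTd (d : ℕ) : Set FinGraph := {G | G.G.IsTree ∧ treeHeightLE G d}

/-- `ℱ_d` : all finite forests of height at most `d`. -/
def classFd (d : ℕ) : Set FinGraph := {G | G.G.IsAcyclic ∧ forestHeightLE G d}

/-- The complete `k`-ary tree `T_{h,k}` of height `h`, on strings over `[k]` of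
length at most `h`; each string of length `< h` is joined to its one-symbol extensions. -/
def kAryTree (h k : ℕ) : SimpleGraph {l : List (Fin k) // l.length ≤ h} :=
  SimpleGraph.fromRel (fun a b => ∃ i : Fin k, b.1 = i :: a.1)

/-- For every `k ≥ 1`, the tree `T_{h,k}` is a minor of some graph in `𝒢`. -/
def StackAll (𝒢 : Set FinGraph) (h : ℕ) : Prop :=
  ∀ k : ℕ, 1 ≤ k → ∃ G ∈ 𝒢, ∃ μ : {l : List (Fin k) // l.length ≤ h} → Set (Fin G.n),
    IsMinorMap (kAryTree h k) G.G μ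

/-- `𝒢` has stack depth (exactly) `d`. -/
def HasStackDepth (𝒢 : Set FinGraph) (d : ℕ) : Prop :=
  StackAll 𝒢 d ∧ ¬ StackAll 𝒢 (d + 1)

/-- The tree depth of `G` is at most `h`: there is a rooted forest on the vertex
set of `G` (given by a parent function whose fixed points are the roots) of height
at most `h` whose (ancestor-descendant) closure contains all edges of `G`. -/
def TreeDepthLE {α : Type} (G : SimpleGraph α) (h : ℕ) : Prop :=
  ∃ par : α → α,
    (∀ v : α, par (par^[h] v) = par^[h] v) ∧
    (∀ u v : α, G.Adj u v → (∃ k : ℕ, par^[k] u = v) ∨ (∃ k : ℕ, par^[k] v = u))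

/-- The class `𝒢` has bounded tree depth. -/
def HasBoundedTreeDepth (𝒢 : Set FinGraph) : Prop :=
  ∃ h : ℕ, ∀ G ∈ 𝒢, TreeDepthLE G.G h

/-- The class `𝒢` has bounded treewidth (via tree decompositions). -/
def HasBoundedTreewidth (𝒢 : Set FinGraph) : Prop :=
  ∃ w : ℕ, ∀ G ∈ 𝒢, ∃ H : FinGraph, H.G.IsTree ∧
    ∃ B : Fin H.n → Set (Fin G.n), IsDecomposition G.G H.G B ∧ ∀ h, (B h).ncard ≤ w + 1

/-- The class `𝒢` has bounded pathwidth (via path decompositions). -/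
def HasBoundedPathwidth (𝒢 : Set FinGraph) : Prop :=
  ∃ w : ℕ, ∀ G ∈ 𝒢, ∃ H : FinGraph, H ∈ classP ∧
    ∃ B : Fin H.n → Set (Fin G.n), IsDecomposition G.G H.G B ∧ ∀ h, (B h).ncard ≤ w + 1

/-- A finite rooted tree. -/
structure RootedFinTree where
  n : ℕ
  G : SimpleGraph (Fin n)
  isTree : G.IsTree
  root : Fin n

/-- `c` is a child of `p` in the rooted tree `T`. -/
def RootedFinTree.IsChild (T : RootedFinTree) (p c : Fin T.n) : Prop :=
  T.G.Adj p c ∧ T.G.dist T.root c = T.G.dist T.root p + 1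

/-- `a` is an ancestor of `v` in the rooted tree `T` (i.e. `a` lies on the unique
path from the root to `v`). -/
def RootedFinTree.Ancestor (T : RootedFinTree) (a v : Fin T.n) : Prop :=
  T.G.dist T.root v = T.G.dist T.root a + T.G.dist a v

/-- `(μ m)_{m}` is a nice `M`-deconstruction of `G`, for rooted trees `M`, `G`. -/
def IsNiceDecon (M G : RootedFinTree) (μ : Fin M.n → Set (Fin G.n)) : Prop :=
  IsDeconstruction G.G M.G μ ∧
  IsMinorMap M.G G.G μ ∧
  G.root ∈ μ M.root ∧
  (∀ (m m' : Fin M.n) (g g' : Fin G.n),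
    M.IsChild m m' → g ∈ μ m → g' ∈ μ m' → G.G.Adj g g' → G.IsChild g g')

/-- The node `u` of the rooted tree `T` has property `P(d,k)`. -/
def PropP (T : RootedFinTree) (k : ℕ) : ℕ → Fin T.n → Prop
  | 0, _ => True
  | d + 1, u => ∃ s : Finset (Fin T.n), s.card = k ∧
      (∀ v ∈ s, T.Ancestor u v) ∧
      (∀ v ∈ s, ∀ w ∈ s, v ≠ w → ¬ T.Ancestor v w ∧ ¬ T.Ancestor w v) ∧
      (∀ v ∈ s, PropP T k d v)

lemma connSet_iff {α : Type} (G : SimpleGraph α) (s : Set α) :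
    ConnSet G s ↔ s.Nonempty ∧ ∀ P : α → Prop,
      (∀ a ∈ s, ∀ b ∈ s, G.Adj a b → P a → P b) → ∀ a ∈ s, ∀ b ∈ s, P a → P b := by
  constructor
  · intro h
    refine ⟨?_, ?_⟩
    · obtain ⟨x⟩ := h.nonempty
      exact ⟨x.1, x.2⟩
    · intro P hP a ha b hb hPa
      obtain ⟨p⟩ := h.preconnected ⟨a, ha⟩ ⟨b, hb⟩
      have key : ∀ (u v : s) (p : (G.induce s).Walk u v), P u.1 → P v.1 := by
        intro u v p
        induction p with
        | nil => exact id
        | cons hadj _ ih =>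
          intro hu
          exact ih (hP _ (Subtype.property _) _ (Subtype.property _) hadj hu)
      exact key _ _ p hPa
  · rintro ⟨⟨x, hx⟩, h⟩
    have : Nonempty s := ⟨⟨x, hx⟩⟩
    refine ⟨?_⟩
    rintro ⟨a, ha⟩ ⟨b, hb⟩
    have := h (fun y => ∃ hy : y ∈ s, (G.induce s).Reachable ⟨a, ha⟩ ⟨y, hy⟩) ?_ a ha b hb
      ⟨ha, Reachable.refl _⟩
    · exact this.2
    · rintro u hu v hv huv ⟨_, hr⟩
      refine ⟨hv, hr.trans (Adj.reachable ?_)⟩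
      exact huv

lemma ConnSet.nonempty' {α : Type} {G : SimpleGraph α} {s : Set α} (h : ConnSet G s) :
    s.Nonempty := ((connSet_iff G s).1 h).1

lemma ConnSet.ind {α : Type} {G : SimpleGraph α} {s : Set α} (h : ConnSet G s) (P : α → Prop)
    (hP : ∀ a ∈ s, ∀ b ∈ s, G.Adj a b → P a → P b) {a b : α} (ha : a ∈ s) (hb : b ∈ s)
    (hPa : P a) : P b := ((connSet_iff G s).1 h).2 P hP a ha b hb hPa

lemma ConnSet.const {α γ : Type} {G : SimpleGraph α} {s : Set α} (h : ConnSet G s) (f : α → γ)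
    (hf : ∀ a ∈ s, ∀ b ∈ s, G.Adj a b → f a = f b) {a b : α} (ha : a ∈ s) (hb : b ∈ s) :
    f a = f b :=
  h.ind (fun x => f a = f x) (fun u hu v hv huv e => e.trans (hf u hu v hv huv)) ha hb rfl

lemma connSet_of_root {α : Type} {G : SimpleGraph α} {s : Set α} (x : α) (hx : x ∈ s)
    (h : ∀ P : α → Prop, (∀ a ∈ s, ∀ b ∈ s, G.Adj a b → P a → P b) → P x → ∀ b ∈ s, P b) :
    ConnSet G s := by
  rw [connSet_iff]
  refine ⟨⟨x, hx⟩, fun P hP a ha b hb hPa => ?_⟩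
  refine h P hP ?_ b hb
  by_contra hn
  refine h (fun y => P y → False) ?_ hn a ha hPa
  intro u hu v hv huv h1 h2
  exact h1 (hP v hv u hu huv.symm h2)

lemma connSet_singleton {α : Type} (G : SimpleGraph α) (x : α) : ConnSet G {x} := by
  refine connSet_of_root x rfl ?_
  rintro P _ hx b rfl
  exact hx

lemma connSet_insert {α : Type} {G : SimpleGraph α} {s : Set α} (h : ConnSet G s) {x y : α}
    (hy : y ∈ s) (hxy : G.Adj x y) : ConnSet G (insert x s) := by
  refine connSet_of_root y (Or.inr hy) ?_
  rintro P hP hPy b (rfl | hb)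
  · exact hP y (Or.inr hy) b (Or.inl rfl) hxy.symm hPy
  · exact h.ind P (fun u hu v hv => hP u (Or.inr hu) v (Or.inr hv)) hy hb hPy

/-- transitivity of deconstructions -/
lemma DeconLE.trans {A B C : Set FinGraph} (h1 : DeconLE A B) (h2 : DeconLE B C) :
    DeconLE A C := by
  obtain ⟨w1, h1⟩ := h1
  obtain ⟨w2, h2⟩ := h2
  refine ⟨w2 * w1, fun G hG => ?_⟩
  obtain ⟨H, hH, β, ⟨cov1, con1⟩, wid1⟩ := h1 G hG
  obtain ⟨K, hK, γ, ⟨cov2, con2⟩, wid2⟩ := h2 H hH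
  refine ⟨K, hK, fun k => ⋃ h ∈ γ k, β h, ⟨?_, ?_⟩, ?_⟩
  · intro g g' hgg
    obtain ⟨h, h', hh, hg, hg'⟩ := cov1 g g' hgg
    obtain ⟨k, k', hk, hkh, hkh'⟩ := cov2 h h' hh
    refine ⟨k, k', hk, ?_, ?_⟩
    · simp only [Set.mem_union, Set.mem_iUnion] at *
      rcases hg with hg | hg
      · rcases hkh with hkh | hkh
        · exact Or.inl ⟨_, hkh, hg⟩
        · exact Or.inr ⟨_, hkh, hg⟩
      · rcases hkh' with hkh | hkh
        · exact Or.inl ⟨_, hkh, hg⟩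
        · exact Or.inr ⟨_, hkh, hg⟩
    · simp only [Set.mem_union, Set.mem_iUnion] at *
      rcases hg' with hg | hg
      · rcases hkh with hkh | hkh
        · exact Or.inl ⟨_, hkh, hg⟩
        · exact Or.inr ⟨_, hkh, hg⟩
      · rcases hkh' with hkh | hkh
        · exact Or.inl ⟨_, hkh, hg⟩
        · exact Or.inr ⟨_, hkh, hg⟩
  · intro g
    obtain ⟨h0, hh0⟩ := (con1 g).nonempty'
    obtain ⟨k0, hk0⟩ := (con2 h0).nonempty'
    refine connSet_of_root k0 (by simp only [Set.mem_ofPred_eq, Set.mem_iUnion] at *; exact ⟨h0, hk0, hh0⟩) ?_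
    intro P hP hPk0 k hk
    simp only [Set.mem_ofPred_eq, Set.mem_iUnion] at hk
    obtain ⟨h, hkh, hgh⟩ := hk
    have inner : ∀ h, g ∈ β h → ∀ k k', h ∈ γ k → h ∈ γ k' → P k → P k' := by
      intro h hg k k' hk hk' hPk
      refine (con2 h).ind P ?_ hk hk' hPk
      intro a ha b hb hab
      refine hP a ?_ b ?_ hab
      · simp only [Set.mem_ofPred_eq, Set.mem_iUnion] at *; exact ⟨h, ha, hg⟩
      · simp only [Set.mem_ofPred_eq, Set.mem_iUnion] at *; exact ⟨h, hb, hg⟩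
    have outer : ∀ k, h ∈ γ k → P k := by
      refine (con1 g).ind (fun h => ∀ k, h ∈ γ k → P k) ?_ hh0 hgh ?_
      · intro a ha b hb hab hPa k hk
        obtain ⟨k1, k2, hk12, ha12, hb12⟩ := cov2 a b (Or.inr hab)
        have m1 : ∀ c, g ∈ β c → ∀ k, c ∈ γ k → k ∈ {h | g ∈ ⋃ h_1 ∈ γ h, β h_1} := by
          intro c hc k hk
          simp only [Set.mem_ofPred_eq, Set.mem_iUnion]; exact ⟨c, hk, hc⟩
        have : ∃ k', b ∈ γ k' ∧ P k' := by
          rcases ha12 with ha1 | ha2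
          · rcases hb12 with hb1 | hb2
            · exact ⟨k1, hb1, hPa _ ha1⟩
            · refine ⟨k2, hb2, ?_⟩
              rcases hk12 with rfl | hk12
              · exact hPa _ ha1
              · exact hP _ (m1 a ha _ ha1) _ (m1 b hb _ hb2) hk12 (hPa _ ha1)
          · rcases hb12 with hb1 | hb2
            · refine ⟨k1, hb1, ?_⟩
              rcases hk12 with rfl | hk12
              · exact hPa _ ha2
              · exact hP _ (m1 a ha _ ha2) _ (m1 b hb _ hb1) hk12.symm (hPa _ ha2)
            · exact ⟨k2, hb2, hPa _ ha2⟩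
        obtain ⟨k', hk', hPk'⟩ := this
        exact inner b hb k' k hk' hk hPk'
      · intro k hk
        exact inner h0 hh0 k0 k hk0 hk hPk0
    exact outer k hkh
  · intro k k' hk
    have e : ((⋃ h ∈ γ k, β h) ∪ ⋃ h ∈ γ k', β h) = ⋃ h ∈ (Set.toFinite (γ k ∪ γ k')).toFinset, β h := by
      ext x; simp only [Set.mem_union, Set.mem_iUnion, Set.Finite.mem_toFinset]; grind
    show ((⋃ h ∈ γ k, β h) ∪ ⋃ h ∈ γ k', β h).ncard ≤ _
    rw [e]
    refine (Finset.set_ncard_biUnion_le _ _).trans ?_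
    refine (Finset.sum_le_card_nsmul _ _ w1 ?_).trans ?_
    · intro h _
      simpa using wid1 h h (Or.inl rfl)
    · rw [smul_eq_mul, ← Set.ncard_eq_toFinset_card]
      exact Nat.mul_le_mul_right _ (wid2 k k' hk)

lemma DeconLE.mono_left {A A' B : Set FinGraph} (h : DeconLE A B) (hA : A' ⊆ A) :
    DeconLE A' B := by
  obtain ⟨w, h⟩ := h
  exact ⟨w, fun G hG => h G (hA hG)⟩

lemma DeconLE.mono_right {A B B' : Set FinGraph} (h : DeconLE A B) (hB : B ⊆ B') :
    DeconLE A B' := by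
  obtain ⟨w, h⟩ := h
  refine ⟨w, fun G hG => ?_⟩
  obtain ⟨H, hH, r⟩ := h G hG
  exact ⟨H, hB hH, r⟩

lemma classTd_sub (d : ℕ) : classTd d ⊆ classFd d := by
  rintro G ⟨hT, r, hr⟩
  refine ⟨hT.isAcyclic, fun v => ⟨r, hT.connected.preconnected r v, fun u _ => hr u⟩⟩

/-- minors give deconstructions of width 2 -/
lemma minor_decon {α β : Type} {M : SimpleGraph α} {G : SimpleGraph β} {μ : α → Set β}
    (h : IsMinorMap M G μ) :
    IsDeconstruction M G (fun g => {m | g ∈ μ m}) ∧ DeconWidthLE G (fun g => {m | g ∈ μ m}) 2 := by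
  obtain ⟨h1, h2, h3⟩ := h
  refine ⟨⟨?_, ?_⟩, ?_⟩
  · rintro m m' (rfl | hm)
    · obtain ⟨x, hx⟩ := (h1 m).nonempty'
      exact ⟨x, x, Or.inl rfl, Or.inl hx, Or.inl hx⟩
    · obtain ⟨g, hg, g', hg', hgg⟩ := h3 m m' hm
      exact ⟨g, g', Or.inr hgg, Or.inl hg, Or.inr hg'⟩
  · intro m
    exact h1 m
  · intro g g' _
    have hs : ∀ g, ({m | g ∈ μ m} : Set α).ncard ≤ 1 := by
      intro g
      have hsub : ({m | g ∈ μ m} : Set α).Subsingleton := by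
        intro a ha b hb
        by_contra hab
        exact Set.disjoint_left.1 (h2 a b hab) ha hb
      exact (Set.ncard_le_one_iff (hsub.finite)).2 (fun ha hb => hsub ha hb)
    refine (Set.ncard_union_le _ _).trans ?_
    exact Nat.add_le_add (hs g) (hs g')

lemma minor_comp {α β γ : Type} {M : SimpleGraph α} {N : SimpleGraph β} {G : SimpleGraph γ}
    {μ : β → Set γ} (h : IsMinorMap N G μ) (f : α → β) (hf : Function.Injective f)
    (hadj : ∀ a b, M.Adj a b → N.Adj (f a) (f b)) : IsMinorMap M G (fun a => μ (f a)) :=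
  ⟨fun _ => h.1 _, fun _ _ hm => h.2.1 _ _ (fun e => hm (hf e)),
    fun _ _ hm => h.2.2 _ _ (hadj _ _ hm)⟩

lemma kAry_adj {h k : ℕ} (a b : {l : List (Fin k) // l.length ≤ h}) :
    (kAryTree h k).Adj a b ↔ (∃ i, b.1 = i :: a.1) ∨ (∃ i, a.1 = i :: b.1) := by
  unfold kAryTree
  rw [SimpleGraph.fromRel_adj]
  constructor
  · rintro ⟨_, h⟩; exact h
  · intro h
    refine ⟨?_, h⟩
    rintro rfl
    rcases h with ⟨i, hi⟩ | ⟨i, hi⟩ <;> simpa using congrArg List.length hi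

lemma kAry_walk {h k : ℕ} : ∀ (l : List (Fin k)) (hl : l.length ≤ h),
    ∃ p : (kAryTree h k).Walk ⟨[], Nat.zero_le _⟩ ⟨l, hl⟩, p.length ≤ l.length := by
  intro l
  induction l with
  | nil => intro hl; exact ⟨Walk.nil, le_refl _⟩
  | cons i l ih =>
    intro hl
    obtain ⟨p, hp⟩ := ih (by simp at hl; omega)
    refine ⟨p.concat ((kAry_adj _ _).2 (Or.inl ⟨i, rfl⟩)), ?_⟩
    simpa using hp

instance kAryFinite (h k : ℕ) : Finite {l : List (Fin k) // l.length ≤ h} :=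
  (List.finite_length_le (Fin k) h).to_subtype

lemma kAry_isTree (h k : ℕ) : (kAryTree h k).IsTree := by
  have hne : Nonempty {l : List (Fin k) // l.length ≤ h} := ⟨⟨[], Nat.zero_le _⟩⟩
  have hc : (kAryTree h k).Connected := by
    have hr : ∀ v, (kAryTree h k).Reachable ⟨[], Nat.zero_le _⟩ v := by
      rintro ⟨l, hl⟩
      obtain ⟨p, _⟩ := kAry_walk l hl
      exact ⟨p⟩
    exact ⟨fun u v => (hr u).symm.trans (hr v)⟩
  rw [isTree_iff_connected_and_card]
  refine ⟨hc, le_antisymm ?_ hc.card_vert_le_card_edgeSet_add_one⟩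
  classical
  have hfin := Fintype.ofFinite {l : List (Fin k) // l.length ≤ h}
  let root : {l : List (Fin k) // l.length ≤ h} := ⟨[], Nat.zero_le _⟩
  let tl : {l : List (Fin k) // l.length ≤ h} → {l : List (Fin k) // l.length ≤ h} :=
    fun a => ⟨a.1.tail, by have := a.2; simp; omega⟩
  let F : {a : {l : List (Fin k) // l.length ≤ h} // a ≠ root} → (kAryTree h k).edgeSet :=
    fun a => ⟨s(tl a.1, a.1), by
      rw [SimpleGraph.mem_edgeSet, kAry_adj]
      left
      obtain ⟨⟨l, hl⟩, ha⟩ := a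
      cases l with
      | nil => exact absurd rfl ha
      | cons i l => exact ⟨i, rfl⟩⟩
  have hF : Function.Surjective F := by
    rintro ⟨e, he⟩
    induction e using Sym2.ind with
    | _ a b =>
      rw [SimpleGraph.mem_edgeSet, kAry_adj] at he
      rcases he with ⟨i, hi⟩ | ⟨i, hi⟩
      · refine ⟨⟨b, ?_⟩, ?_⟩
        · rintro rfl; simp [root] at hi
        · apply Subtype.ext
          have : tl b = a := Subtype.ext (by simp [tl, hi])
          simp [F, this]
      · refine ⟨⟨a, ?_⟩, ?_⟩
        · rintro rfl; simp [root] at hi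
        · apply Subtype.ext
          have : tl a = b := Subtype.ext (by simp [tl, hi])
          simp [F, this, Sym2.eq_swap]
  have h1 := Nat.card_le_card_of_surjective F hF
  have h2 : Nat.card {a : {l : List (Fin k) // l.length ≤ h} // a ≠ root} + 1
      = Nat.card {l : List (Fin k) // l.length ≤ h} := by
    rw [Nat.card_eq_fintype_card, Nat.card_eq_fintype_card, Fintype.card_subtype_compl,
      Fintype.card_subtype_eq]
    have := Fintype.card_pos (α := {l : List (Fin k) // l.length ≤ h})
    omega
  omega

/-- transport a finite graph to `Fin n` -/
lemma exists_finGraph {β : Type} [Finite β] (H : SimpleGraph β) :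
    ∃ M : FinGraph, Nonempty (H ≃g M.G) := by
  have := Fintype.ofFinite β
  let e := Fintype.equivFin β
  exact ⟨⟨Fintype.card β, H.map e.toEmbedding⟩, ⟨SimpleGraph.Iso.map e H⟩⟩

lemma connSet_iso {β γ : Type} {H : SimpleGraph β} {M : SimpleGraph γ} (e : H ≃g M) {s : Set β}
    (hs : ConnSet H s) : ConnSet M {m | e.symm m ∈ s} := by
  obtain ⟨x, hx⟩ := hs.nonempty'
  refine connSet_of_root (e x) (by simpa using hx) ?_
  intro P hP hPx b hb
  have := hs.ind (fun y => P (e y)) ?_ hx hb hPx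
  · simpa using this
  · intro a ha b hb hab
    exact hP _ (by simpa using ha) _ (by simpa using hb) (e.map_adj_iff.2 hab)

lemma decon_iso_right {α β γ : Type} {G : SimpleGraph α} {H : SimpleGraph β} {M : SimpleGraph γ}
    (e : H ≃g M) {B : β → Set α} {w : ℕ} (h : IsDeconstruction G H B) (hw : DeconWidthLE H B w) :
    IsDeconstruction G M (fun m => B (e.symm m)) ∧ DeconWidthLE M (fun m => B (e.symm m)) w := by
  refine ⟨⟨?_, ?_⟩, ?_⟩
  · intro g g' hg
    obtain ⟨x, y, hxy, h1, h2⟩ := h.1 g g' hg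
    refine ⟨e x, e y, ?_, by simpa using h1, by simpa using h2⟩
    rcases hxy with rfl | hxy
    · exact Or.inl rfl
    · exact Or.inr (e.map_adj_iff.2 hxy)
  · intro g
    exact connSet_iso e (h.2 g)
  · intro x y hxy
    refine hw _ _ ?_
    rcases hxy with rfl | hxy
    · exact Or.inl rfl
    · exact Or.inr (e.symm.map_adj_iff.2 hxy)

lemma decon_iso_left {α β γ : Type} {G : SimpleGraph α} {H : SimpleGraph β} {M : SimpleGraph γ}
    (e : G ≃g M) {B : β → Set γ} {w : ℕ} (h : IsDeconstruction M H B) (hw : DeconWidthLE H B w) :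
    IsDeconstruction G H (fun h => {g | e g ∈ B h}) ∧
      DeconWidthLE H (fun h => {g | e g ∈ B h}) w := by
  refine ⟨⟨?_, ?_⟩, ?_⟩
  · intro g g' hg
    refine h.1 (e g) (e g') ?_
    rcases hg with rfl | hg
    · exact Or.inl rfl
    · exact Or.inr (e.map_adj_iff.2 hg)
  · intro g
    exact h.2 (e g)
  · intro x y hxy
    refine le_trans (le_of_eq ?_) (hw x y hxy)
    show (e ⁻¹' (B x ∪ B y)).ncard = _
    exact Set.ncard_preimage_of_injective_subset_range e.injective (fun z _ => e.surjective z)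

lemma kAry_mem_classTd {h k : ℕ} {M : FinGraph} (e : kAryTree h k ≃g M.G) : M ∈ classTd h := by
  refine ⟨(e.isTree_iff).1 (kAry_isTree h k), e ⟨[], Nat.zero_le _⟩, fun v => ?_⟩
  obtain ⟨p, hp⟩ := kAry_walk (e.symm v).1 (e.symm v).2
  have hd := SimpleGraph.dist_le (p.map e.toHom)
  have : e.toHom (e.symm v) = v := e.apply_symm_apply v
  have h2 : M.G.dist (e.toHom ⟨[], Nat.zero_le _⟩) (e.toHom (e.symm v)) ≤ h := by
    refine hd.trans ?_
    rw [Walk.length_map]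
    exact hp.trans (e.symm v).2
  rw [this] at h2
  exact h2

/-- The forest of nonempty strings of length at most `h + 1`. -/
def kAryForest (h k : ℕ) : SimpleGraph {l : {l : List (Fin k) // l.length ≤ h + 1} // l.1 ≠ []} :=
  (kAryTree (h + 1) k).comap Subtype.val

lemma kAryForest_walk {h k : ℕ} (c : Fin k) : ∀ (l : List (Fin k)) (hl : (l ++ [c]).length ≤ h + 1),
    ∃ p : (kAryForest h k).Walk ⟨⟨[c], by simp⟩, by simp⟩ ⟨⟨l ++ [c], hl⟩, by simp⟩,
      p.length ≤ l.length := by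
  intro l
  induction l with
  | nil => intro hl; exact ⟨Walk.nil, le_refl _⟩
  | cons i l ih =>
    intro hl
    obtain ⟨p, hp⟩ := ih (by simp at hl ⊢; omega)
    have hadj : (kAryForest h k).Adj ⟨⟨l ++ [c], by simp at hl ⊢; omega⟩, by simp⟩
        ⟨⟨(i :: l) ++ [c], hl⟩, by simp⟩ := (kAry_adj _ _).2 (Or.inl ⟨i, rfl⟩)
    refine ⟨p.concat hadj, ?_⟩
    rw [Walk.length_concat]
    simpa using hp

lemma kAryForest_mem_classFd {h k : ℕ} {M : FinGraph} (e : kAryForest h k ≃g M.G) :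
    M ∈ classFd h := by
  refine ⟨(e.isAcyclic_iff).1
    ((kAry_isTree (h + 1) k).isAcyclic.of_comap ⟨Subtype.val, Subtype.val_injective⟩), fun v => ?_⟩
  have key : ∀ u : {l : {l : List (Fin k) // l.length ≤ h + 1} // l.1 ≠ []},
      ∃ q : (kAryForest h k).Walk ⟨⟨[u.1.1.getLast u.2], by simp⟩, by simp⟩ u, q.length ≤ h := by
    rintro ⟨⟨l, hl⟩, hne⟩
    rcases List.eq_nil_or_concat' l with rfl | ⟨l', c, rfl⟩
    · exact absurd rfl hne
    · obtain ⟨q, hq⟩ := kAryForest_walk (h := h) c l' (by simpa using hl)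
      have e1 : (⟨⟨[(l' ++ [c]).getLast hne], by simp⟩, by simp⟩ :
        {l : {l : List (Fin k) // l.length ≤ h + 1} // l.1 ≠ []}) = ⟨⟨[c], by simp⟩, by simp⟩ := by
        simp
      refine ⟨q.copy e1.symm rfl, ?_⟩
      simp at hl
      simp; omega
  have hlast : ∀ u u' : {l : {l : List (Fin k) // l.length ≤ h + 1} // l.1 ≠ []},
      (kAryForest h k).Reachable u u' → u.1.1.getLast u.2 = u'.1.1.getLast u'.2 := by
    rintro u u' ⟨p⟩
    induction p with
    | nil => rfl
    | @cons a b c hadj _ ih =>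
      rw [← ih]
      have hadj' := (kAry_adj _ _).1 hadj
      obtain ⟨⟨la, _⟩, ha⟩ := a
      obtain ⟨⟨lb, _⟩, hb⟩ := b
      rcases hadj' with ⟨i, hi⟩ | ⟨i, hi⟩
      · simp only at hi ha hb ⊢; subst hi; rw [List.getLast_cons]
      · simp only at hi ha hb ⊢; subst hi; rw [List.getLast_cons]
  obtain ⟨q, hq⟩ := key (e.symm v)
  refine ⟨_, ⟨(q.map e.toHom).copy rfl (e.apply_symm_apply v)⟩, ?_⟩
  intro u hu
  obtain ⟨q', hq'⟩ := key (e.symm u)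
  have hl := hlast _ _ (hu.map e.symm.toHom)
  have hx : ((⟨⟨[(e.symm u).1.1.getLast (e.symm u).2], by simp⟩, by simp⟩ :
        {l : {l : List (Fin k) // l.length ≤ h + 1} // l.1 ≠ []})) =
      ⟨⟨[(e.symm v).1.1.getLast (e.symm v).2], by simp⟩, by simp⟩ := by
    have h3 : e.symm.toHom (e.toHom (⟨⟨[(e.symm v).1.1.getLast (e.symm v).2], by simp⟩, by simp⟩ :
        {l : {l : List (Fin k) // l.length ≤ h + 1} // l.1 ≠ []})) = 
        ⟨⟨[(e.symm v).1.1.getLast (e.symm v).2], by simp⟩, by simp⟩ := e.symm_apply_apply _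
    have h4 : e.symm.toHom u = e.symm u := rfl
    simp only [h3, h4, List.getLast_singleton] at hl
    simp only [hl]
  have hd := SimpleGraph.dist_le (((q'.copy hx rfl).map e.toHom).copy rfl (e.apply_symm_apply u))
  refine hd.trans ?_
  simpa using hq'
lemma acyclic_lists {V : Type} (G : SimpleGraph V) (hG : G.IsAcyclic) (rt : V → V)
    (hr : ∀ v, G.Reachable v (rt v)) (hadj : ∀ u v, G.Adj u v → rt u = rt v) :
    ∃ f : V → List V, (∀ v, ∃ t, f v = v :: t) ∧ (∀ v, ∃ t, f v = t ++ [rt v]) ∧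
      (∀ v, (f v).length ≤ G.dist v (rt v) + 1) ∧
      (∀ u v, G.Adj u v → f v = v :: f u ∨ f u = u :: f v) := by
  classical
  have hp : ∀ v, ∃ p : G.Walk v (rt v), p.IsPath ∧ p.length = G.dist v (rt v) :=
    fun v => (hr v).exists_path_of_dist
  choose p hp hlen using hp
  refine ⟨fun v => (p v).support, ?_, ?_, ?_, ?_⟩
  · intro v
    exact ⟨_, (Walk.cons_tail_support (p v)).symm⟩
  · intro v
    refine ⟨(p v).support.dropLast, ?_⟩
    have h1 := List.dropLast_append_getLast (Walk.support_ne_nil (p v))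
    rw [Walk.getLast_support] at h1
    exact h1.symm
  · intro v
    simp [Walk.length_support, hlen]
  · intro u v huv
    have e := hadj u v huv
    by_cases hv : v ∈ (p u).support
    · right
      have h1 : ((p u).takeUntil v hv) = Walk.cons huv Walk.nil := by
        have := (hG.subsingleton_path _ _).elim ⟨(p u).takeUntil v hv, (hp u).takeUntil hv⟩
          ⟨Walk.cons huv Walk.nil, by simp [huv.ne]⟩
        exact congrArg Subtype.val this
      have h2 : ((p u).dropUntil v hv).copy rfl e = p v := by
        have := (hG.subsingleton_path _ _).elim ⟨((p u).dropUntil v hv).copy rfl e, by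
          simpa using (hp u).dropUntil hv⟩ ⟨p v, hp v⟩
        exact congrArg Subtype.val this
      have h3 := Walk.take_spec (p u) hv
      have h4 : (p v).support = ((p u).dropUntil v hv).support := by rw [← h2]; simp
      show (p u).support = u :: (p v).support
      have h5 := congrArg Walk.support h3
      rw [h1] at h5
      rw [h4, ← h5]
      simp
    · left
      have h2 : Walk.cons huv.symm ((p u).copy rfl e) = p v := by
        have := (hG.subsingleton_path _ _).elim ⟨Walk.cons huv.symm ((p u).copy rfl e), by
          simp [hp u, hv]⟩ ⟨p v, hp v⟩
        exact congrArg Subtype.val this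
      show (p v).support = v :: (p u).support
      rw [← h2]; simp

lemma forest_embed {d : ℕ} {F : FinGraph} (hF : F ∈ classFd d) :
    ∃ f : Fin F.n → List (Fin F.n), Function.Injective f ∧ (∀ v, f v ≠ []) ∧
      (∀ v, (f v).length ≤ d + 1) ∧
      (∀ u v, F.G.Adj u v → (∃ i, f v = i :: f u) ∨ (∃ i, f u = i :: f v)) := by
  obtain ⟨hA, hh⟩ := hF
  choose ρ h1 h2 using hh
  let rt : Fin F.n → Fin F.n := fun v => ρ (Quot.out (F.G.connectedComponentMk v))
  have hout : ∀ v, F.G.Reachable (Quot.out (F.G.connectedComponentMk v)) v := by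
    intro v
    apply ConnectedComponent.exact
    exact Quot.out_eq (F.G.connectedComponentMk v)
  obtain ⟨f, hf1, hf2, hf3, hf4⟩ := acyclic_lists F.G hA rt
    (fun v => ((h1 _).trans (hout v)).symm) (by
      intro u v huv
      have : F.G.connectedComponentMk u = F.G.connectedComponentMk v :=
        ConnectedComponent.sound huv.reachable
      simp only [rt, this])
  refine ⟨f, ?_, ?_, ?_, ?_⟩
  · intro a b hab
    obtain ⟨t, ht⟩ := hf1 a
    obtain ⟨t', ht'⟩ := hf1 b
    rw [ht, ht'] at hab
    exact (List.cons.inj hab).1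
  · intro v
    obtain ⟨t, ht⟩ := hf1 v
    rw [ht]; simp
  · intro v
    refine (hf3 v).trans ?_
    rw [SimpleGraph.dist_comm]
    exact Nat.succ_le_succ (h2 _ v ((h1 _).trans (hout v)))
  · intro u v huv
    rcases hf4 u v huv with h | h
    · exact Or.inl ⟨_, h⟩
    · exact Or.inr ⟨_, h⟩

lemma tree_embed {d : ℕ} {F : FinGraph} (hF : F ∈ classTd d) :
    ∃ f : Fin F.n → List (Fin F.n), Function.Injective f ∧
      (∀ v, (f v).length ≤ d) ∧
      (∀ u v, F.G.Adj u v → (∃ i, f v = i :: f u) ∨ (∃ i, f u = i :: f v)) := by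
  obtain ⟨hT, r, hr⟩ := hF
  obtain ⟨f, hf1, hf2, hf3, hf4⟩ := acyclic_lists F.G hT.isAcyclic (fun _ => r)
    (fun v => hT.connected.preconnected v r) (fun _ _ _ => rfl)
  choose g hg using hf2
  refine ⟨g, ?_, ?_, ?_⟩
  · intro a b hab
    obtain ⟨t, ht⟩ := hf1 a
    obtain ⟨t', ht'⟩ := hf1 b
    have : f a = f b := by rw [hg a, hg b, hab]
    rw [ht, ht'] at this
    exact (List.cons.inj this).1
  · intro v
    have h1 := hf3 v
    rw [hg v, SimpleGraph.dist_comm] at h1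
    have := hr v
    simp at h1; omega
  · intro u v huv
    rcases hf4 u v huv with h | h
    · left
      rw [hg v, hg u, ← List.cons_append] at h
      exact ⟨v, List.append_cancel_right h⟩
    · right
      rw [hg v, hg u, ← List.cons_append] at h
      exact ⟨u, List.append_cancel_right h⟩

/-- the suffix of length `m` -/
def suf {A : Type} (m : ℕ) (l : List A) : List A := l.drop (l.length - m)

lemma suf_cons {A : Type} {m : ℕ} {l : List A} (i : A) (h : m ≤ l.length) :
    suf m (i :: l) = suf m l := by
  unfold suf
  have : (i :: l).length - m = (l.length - m) + 1 := by simp; omega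
  rw [this, List.drop_succ_cons]

lemma no_decon_aux {β A : Type} [Finite A] {D k w : ℕ} (hk : w < k) (H : SimpleGraph β)
    (B : β → Set {l : List (Fin k) // l.length ≤ D})
    (hB : IsDeconstruction (kAryTree D k) H B) (hw : DeconWidthLE H B w)
    (f : β → List A) (hf : Function.Injective f)
    (hadj : ∀ u v, H.Adj u v → (∃ i, f v = i :: f u) ∨ (∃ i, f u = i :: f v)) :
    ∀ (j : ℕ) (p : List (Fin k)) (_ : p.length + j = D) (s : List A)
      (_ : ∀ l : {l : List (Fin k) // l.length ≤ D}, p <:+ l.1 → ∀ h, l ∈ B h →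
        s <:+ f h ∧ s.length < (f h).length ∧ (f h).length ≤ s.length + j), False := by
  intro j
  induction j with
  | zero =>
    intro p hp s hs
    obtain ⟨h, hh⟩ := (hB.2 ⟨p, by omega⟩).nonempty'
    have := hs ⟨p, by omega⟩ (List.suffix_refl _) h hh
    omega
  | succ j ih =>
    intro p hp s hs
    -- adjacency preserves the suffix
    have hedge : ∀ h h', reflAdj H h h' → s.length < (f h).length → s.length < (f h').length →
        suf (s.length + 1) (f h) = suf (s.length + 1) (f h') := by
      rintro h h' (rfl | hh) h1 h2
      · rfl
      · rcases hadj _ _ hh with ⟨i, hi⟩ | ⟨i, hi⟩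
        · rw [hi, suf_cons i h1]
        · rw [hi, suf_cons i h2]
    obtain ⟨h0, hh0⟩ := (hB.2 ⟨p, by omega⟩).nonempty'
    have same : ∀ l : {l : List (Fin k) // l.length ≤ D}, p <:+ l.1 → ∀ h h', l ∈ B h → l ∈ B h' →
        suf (s.length + 1) (f h) = suf (s.length + 1) (f h') := by
      intro l hl h h' hh hh'
      refine (hB.2 l).const (fun h => suf (s.length + 1) (f h)) ?_ hh hh'
      intro a ha b hb hab
      exact hedge a b (Or.inr hab) (hs l hl a ha).2.1 (hs l hl b hb).2.1
    have all : ∀ (t : List (Fin k)) (hl : (t ++ p).length ≤ D), ∀ h, ⟨t ++ p, hl⟩ ∈ B h →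
        suf (s.length + 1) (f h) = suf (s.length + 1) (f h0) := by
      intro t
      induction t with
      | nil => intro hl h hh; exact same ⟨p, by omega⟩ (List.suffix_refl _) h h0 hh hh0
      | cons i t iht =>
        intro hl h hh
        have hl' : (t ++ p).length ≤ D := by simp at hl ⊢; omega
        have hs1 : p <:+ (t ++ p) := List.suffix_append _ _
        have hs2 : p <:+ (i :: t ++ p) := List.suffix_append _ _
        obtain ⟨a, b, hab, h1, h2⟩ := hB.1 ⟨t ++ p, hl'⟩ ⟨i :: t ++ p, hl⟩
          (Or.inr ((kAry_adj _ _).2 (Or.inl ⟨i, rfl⟩)))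
        have : ∃ c c', reflAdj H c c' ∧ ⟨t ++ p, hl'⟩ ∈ B c ∧ ⟨i :: t ++ p, hl⟩ ∈ B c' := by
          rcases h1 with h1 | h1 <;> rcases h2 with h2 | h2
          · exact ⟨a, a, Or.inl rfl, h1, h2⟩
          · exact ⟨a, b, hab, h1, h2⟩
          · exact ⟨b, a, hab.imp Eq.symm Adj.symm, h1, h2⟩
          · exact ⟨b, b, Or.inl rfl, h1, h2⟩
        obtain ⟨c, c', hcc, hc, hc'⟩ := this
        rw [← iht hl' c hc, same _ hs2 h c' hh hc']
        exact (hedge c c' hcc (hs _ hs1 c hc).2.1 (hs _ hs2 c' hc').2.1).symm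
    set s' := suf (s.length + 1) (f h0) with hs'
    have hs'len : s'.length = s.length + 1 := by
      have := (hs ⟨p, by omega⟩ (List.suffix_refl _) h0 hh0).2.1
      rw [hs', suf, List.length_drop]; omega
    -- find a child subtree missing the bag of s'
    have miss : ∃ i : Fin k, ∀ (l : {l : List (Fin k) // l.length ≤ D}), (i :: p) <:+ l.1 →
        ∀ h, l ∈ B h → f h ≠ s' := by
      by_contra hcon
      push Not at hcon
      choose L hL1 h hL2 hL3 using hcon
      have hhc : ∀ i, h i = h ⟨0, by omega⟩ := fun i => hf ((hL3 i).trans (hL3 _).symm)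
      have hinj : Function.Injective L := by
        intro a b hab
        have h1 := hL1 a
        have h2 := hL1 b
        rw [hab] at h1
        have := List.suffix_of_suffix_length_le h1 h2 (by simp)
        have := this.eq_of_length (by simp)
        exact (List.cons.inj this).1
      have hsub : Set.range L ⊆ B (h ⟨0, by omega⟩) := by
        rintro _ ⟨i, rfl⟩
        rw [← hhc i]; exact hL2 i
      have h1 := Set.ncard_le_ncard hsub (Set.toFinite _)
      have h2 := hw (h ⟨0, by omega⟩) _ (Or.inl rfl)
      rw [Set.union_self] at h2
      rw [← Set.image_univ, Set.ncard_image_of_injective _ hinj, Set.ncard_univ,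
        Nat.card_eq_fintype_card, Fintype.card_fin] at h1
      omega
    obtain ⟨i, hi⟩ := miss
    refine ih (i :: p) (by simp; omega) s' ?_
    intro l hl h hh
    have hpl : p <:+ l.1 := (List.suffix_cons i p).trans hl
    obtain ⟨a1, a2, a3⟩ := hs l hpl h hh
    have e1 : suf (s.length + 1) (f h) = s' := by
      obtain ⟨t, ht⟩ := hpl
      obtain ⟨l, hlD⟩ := l
      simp only at ht
      subst ht
      exact all t hlD h hh
    have hsuf : s' <:+ f h := by rw [← e1]; exact List.drop_suffix _ _
    refine ⟨hsuf, ?_, by omega⟩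
    rcases hsuf.length_le.lt_or_eq with h1 | h1
    · exact h1
    · exact absurd (hsuf.eq_of_length h1).symm (hi l hl h hh)

/-- `𝒯_{d+1}` does not reduce to `ℱ_d`. -/
lemma not_Td_le_Fd (d : ℕ) : ¬ DeconLE (classTd (d + 1)) (classFd d) := by
  rintro ⟨w, h⟩
  obtain ⟨M, ⟨e⟩⟩ := exists_finGraph (kAryTree (d + 1) (w + 1))
  obtain ⟨F, hF, B, hB, hw⟩ := h M (kAry_mem_classTd e)
  obtain ⟨hB', hw'⟩ := decon_iso_left e hB hw
  obtain ⟨f, hf, hne, hlen, hadj⟩ := forest_embed hF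
  refine no_decon_aux (Nat.lt_succ_self w) F.G _ hB' hw' f hf hadj (d + 1) [] (by simp) [] ?_
  intro l _ h _
  refine ⟨List.nil_suffix, ?_, by simpa using hlen h⟩
  exact List.length_pos_iff.2 (hne h)
section PathBound

lemma chain_const {V γ : Type} {R : V → V → Prop} (g : V → γ) : ∀ (l : List V), l.IsChain R →
    (∀ a ∈ l, ∀ b ∈ l, R a b → g a = g b) → ∀ a ∈ l, ∀ b ∈ l, g a = g b := by
  intro l
  induction l with
  | nil => simp
  | cons x l ih =>
    intro hc hg
    have ih' := ih (List.IsChain.tail hc) (fun a ha b hb => hg a (List.mem_cons_of_mem _ ha) b (List.mem_cons_of_mem _ hb))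
    have hx : ∀ b ∈ l, g x = g b := by
      intro b hb
      cases l with
      | nil => simp at hb
      | cons y l =>
        have hxy : R x y := by
          rw [List.isChain_cons_cons] at hc; exact hc.1
        exact (hg x (by simp) y (by simp) hxy).trans (ih' y (by simp) b hb)
    intro a ha b hb
    rcases List.mem_cons.1 ha with rfl | ha' <;> rcases List.mem_cons.1 hb with rfl | hb'
    · rfl
    · exact hx b hb'
    · exact (hx a ha').symm
    · exact ih' a ha' b hb'

lemma path_bound {V : Type} {G : SimpleGraph V} {h : ℕ} (hG : TreeDepthLE G h) (l : List V)
    (hc : l.IsChain G.Adj) (hn : l.Nodup) : l.length ≤ 2 ^ (h + 1) := by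
  classical
  obtain ⟨par, hfix, hadj⟩ := hG
  have hex : ∀ v, ∃ k, par (par^[k] v) = par^[k] v := fun v => ⟨h, hfix v⟩
  let dep : V → ℕ := fun v => Nat.find (hex v)
  have dep_zero : ∀ v, dep v = 0 → par v = v := by
    intro v hv
    have := Nat.find_spec (hex v)
    change par (par^[dep v] v) = par^[dep v] v at this
    rw [hv] at this
    exact this
  have dep_succ : ∀ v n, dep v = n + 1 → dep (par v) = n := by
    intro v n hv
    apply le_antisymm
    · apply Nat.find_min'
      have := Nat.find_spec (hex v)
      change par (par^[dep v] v) = par^[dep v] v at this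
      rw [hv] at this
      exact this
    · have h1 : dep v ≤ dep (par v) + 1 := by
        apply Nat.find_min'
        exact Nat.find_spec (hex (par v))
      omega
  let anc : ℕ → V → V := fun t v => par^[dep v - t] v
  have anc_par : ∀ t v, t ≤ dep (par v) → anc t (par v) = anc t v ∧ t ≤ dep v := by
    intro t v ht
    rcases Nat.eq_zero_or_pos (dep v) with h0 | h0
    · have := dep_zero v h0
      rw [this] at ht ⊢
      exact ⟨rfl, ht⟩
    · obtain ⟨n, hn⟩ := Nat.exists_eq_succ_of_ne_zero h0.ne'
      have h1 := dep_succ v n hn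
      refine ⟨?_, by omega⟩
      show par^[dep (par v) - t] (par v) = par^[dep v - t] v
      have : dep v - t = (dep (par v) - t) + 1 := by omega
      rw [this, Function.iterate_succ_apply]
  have anc_iter : ∀ t k v, t ≤ dep (par^[k] v) → anc t (par^[k] v) = anc t v ∧ t ≤ dep v := by
    intro t k
    induction k with
    | zero => intro v hv; exact ⟨rfl, hv⟩
    | succ k ih =>
      intro v hv
      rw [Function.iterate_succ_apply] at hv ⊢
      obtain ⟨h1, h2⟩ := ih _ hv
      obtain ⟨h3, h4⟩ := anc_par t v h2
      exact ⟨h1.trans h3, h4⟩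
  have anc_adj : ∀ t u v, G.Adj u v → t ≤ dep u → t ≤ dep v → anc t u = anc t v := by
    intro t u v huv hu hv
    rcases hadj u v huv with ⟨k, rfl⟩ | ⟨k, rfl⟩
    · exact (anc_iter t k u hv).1.symm
    · exact (anc_iter t k v hu).1
  have main : ∀ j (l : List V), l.IsChain G.Adj → l.Nodup → (∀ x ∈ l, h + 1 ≤ dep x + j) →
      l.length < 2 ^ j := by
    intro j
    induction j with
    | zero =>
      intro l _ _ hl
      cases l with
      | nil => simp
      | cons x l =>
        exfalso
        have h1 := hl x (by simp)
        have h2 : dep x ≤ h := Nat.find_min' _ (hfix x)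
        omega
    | succ j ih =>
      intro l hc hn hl
      by_cases hx : ∃ x ∈ l, dep x + j = h
      · obtain ⟨x, hxl, hx⟩ := hx
        have hanc : ∀ y ∈ l, dep y = dep x → y = x := by
          intro y hy hyx
          have := chain_const (anc (dep x)) l hc (fun a ha b hb hab => anc_adj _ a b hab
            (by have := hl a ha; omega) (by have := hl b hb; omega)) y hy x hxl
          simpa [anc, hyx] using this
        obtain ⟨l1, l2, rfl⟩ := List.append_of_mem hxl
        have c1 : l1.IsChain G.Adj := (List.isChain_append.1 hc).1
        have c2 : l2.IsChain G.Adj := (List.isChain_append.1 hc).2.1.tail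
        have n1 : l1.Nodup := (List.nodup_append.1 hn).1
        have n2 : l2.Nodup := (List.nodup_append.1 hn).2.1.of_cons
        have hm := List.nodup_middle.1 hn
        have hx12 : x ∉ l1 ++ l2 := (List.nodup_cons.1 hm).1
        have hd : ∀ y ∈ l1 ++ l2, h + 1 ≤ dep y + j := by
          intro y hy
          have hyl : y ∈ l1 ++ x :: l2 := by
            simp at hy ⊢; tauto
          have h1 := hl y hyl
          have h2 : dep y ≠ dep x := by
            intro e
            have := hanc y hyl e
            subst this
            exact hx12 hy
          omega
        have i1 := ih l1 c1 n1 (fun y hy => hd y (by simp [hy]))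
        have i2 := ih l2 c2 n2 (fun y hy => hd y (by simp [hy]))
        rw [pow_succ]
        simp
        omega
      · have := ih l hc hn (fun x hxl => by
          have h1 := hl x hxl
          have h2 : dep x + j ≠ h := fun e => hx ⟨x, hxl, e⟩
          omega)
        rw [pow_succ]; omega
  exact (main (h + 1) l hc hn (fun x _ => by omega)).le

end PathBound

/-- A rooted `k`-ary tree minor of height `ρ` inside `S`, with `r` in the root branch set. -/
def RM {V : Type} (G : SimpleGraph V) (k : ℕ) : ℕ → Set V → V → Prop
  | 0, S, r => r ∈ S
  | ρ + 1, S, r => ∃ X : Set V, X ⊆ S ∧ ConnSet G X ∧ r ∈ X ∧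
      ∃ (A : Fin k → Set V) (x : Fin k → V), (∀ i, A i ⊆ S) ∧ (∀ i, Disjoint X (A i)) ∧
        (∀ i j, i ≠ j → Disjoint (A i) (A j)) ∧ (∀ i, ∃ y ∈ X, G.Adj y (x i)) ∧
        ∀ i, RM G k ρ (A i) (x i)

/-- Recursive separability of `S` with depth `d` and separators of size at most `w`. -/
def Lab {V : Type} (G : SimpleGraph V) (w : ℕ) : ℕ → Set V → Prop
  | 0, S => S.ncard ≤ w
  | d + 1, S => ∃ X ⊆ S, X.ncard ≤ w ∧ ∀ C ⊆ S \ X, ConnSet G C → Lab G w d C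

section Core

variable {V : Type} {G : SimpleGraph V}

lemma RM.mem {k ρ : ℕ} {S : Set V} {r : V} (h : RM G k ρ S r) : r ∈ S := by
  cases ρ with
  | zero => exact h
  | succ ρ => obtain ⟨X, hX, _, hr, _⟩ := h; exact hX hr

lemma RM.mono {k ρ : ℕ} {S S' : Set V} {r : V} (h : RM G k ρ S r) (hS : S ⊆ S') :
    RM G k ρ S' r := by
  cases ρ with
  | zero => exact hS h
  | succ ρ =>
    obtain ⟨X, hX, hc, hr, A, x, h1, h2⟩ := h
    exact ⟨X, hX.trans hS, hc, hr, A, x, fun i => (h1 i).trans hS, h2⟩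

lemma RM.extend {k ρ : ℕ} {S : Set V} {r r' : V} (h : RM G k ρ S r) (hr' : r' ∉ S)
    (hadj : G.Adj r' r) : RM G k ρ (insert r' S) r' := by
  cases ρ with
  | zero => exact Set.mem_insert _ _
  | succ ρ =>
    obtain ⟨X, hX, hc, hr, A, x, h1, h2, h3, h4, h5⟩ := h
    refine ⟨insert r' X, Set.insert_subset_insert hX, connSet_insert hc hr hadj,
      Set.mem_insert _ _, A, x, fun i => (h1 i).trans (Set.subset_insert _ _), ?_, h3, ?_, h5⟩
    · intro i
      rw [Set.disjoint_insert_left]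
      exact ⟨fun hh => hr' (h1 i hh), h2 i⟩
    · intro i
      obtain ⟨y, hy, hyx⟩ := h4 i
      exact ⟨y, Set.mem_insert_of_mem _ hy, hyx⟩

lemma RM.down {k : ℕ} : ∀ {ρ : ℕ} {S : Set V} {r : V}, RM G k (ρ + 1) S r → RM G k ρ S r := by
  intro ρ
  induction ρ with
  | zero => intro S r h; exact h.mem
  | succ ρ ih =>
    rintro S r ⟨X, hX, hc, hr, A, x, h1, h2, h3, h4, h5⟩
    exact ⟨X, hX, hc, hr, A, x, h1, h2, h3, h4, fun i => ih (h5 i)⟩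

lemma RM.le {k ρ ρ' : ℕ} {S : Set V} {r : V} (h : RM G k ρ' S r) (hρ : ρ ≤ ρ') :
    RM G k ρ S r := by
  induction ρ', hρ using Nat.le_induction with
  | base => exact h
  | succ n _ ih => exact ih h.down

lemma RM.le_k {k K : ℕ} (hk : k ≤ K) : ∀ {ρ : ℕ} {S : Set V} {r : V}, RM G K ρ S r →
    RM G k ρ S r := by
  intro ρ
  induction ρ with
  | zero => intro S r h; exact h
  | succ ρ ih =>
    rintro S r ⟨X, hX, hc, hr, A, x, h1, h2, h3, h4, h5⟩
    exact ⟨X, hX, hc, hr, fun i => A (Fin.castLE hk i), fun i => x (Fin.castLE hk i),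
      fun i => h1 _, fun i => h2 _,
      fun i j hij => h3 _ _ (fun e => hij (Fin.castLE_injective hk e)), fun i => h4 _,
      fun i => ih (h5 _)⟩

variable [Finite V]

lemma Lab.mono {w : ℕ} : ∀ {d : ℕ} {S S' : Set V}, Lab G w d S → S' ⊆ S → Lab G w d S' := by
  intro d
  cases d with
  | zero =>
    intro S S' h hS
    exact (Set.ncard_le_ncard hS (Set.toFinite _)).trans h
  | succ d =>
    rintro S S' ⟨X, hX, hw, h⟩ hS
    refine ⟨X ∩ S', Set.inter_subset_right,
      (Set.ncard_le_ncard Set.inter_subset_left (Set.toFinite _)).trans hw, ?_⟩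
    intro C hC hcon
    refine h C ?_ hcon
    intro y hy
    have := hC hy
    exact ⟨hS this.1, fun hyX => this.2 ⟨hyX, this.1⟩⟩

lemma Lab.mono_w {w w' : ℕ} (hw : w ≤ w') : ∀ {d : ℕ} {S : Set V}, Lab G w d S →
    Lab G w' d S := by
  intro d
  induction d with
  | zero => intro S h; exact le_trans h hw
  | succ d ih =>
    rintro S ⟨X, hX, hXw, h⟩
    exact ⟨X, hX, hXw.trans hw, fun C hC hcon => ih (h C hC hcon)⟩

lemma Lab.up {w d : ℕ} {S : Set V} (h : Lab G w d S) : Lab G w (d + 1) S :=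
  ⟨∅, Set.empty_subset _, by simp, fun _ hC _ => h.mono (hC.trans Set.sdiff_subset)⟩

lemma Lab.le {w d d' : ℕ} {S : Set V} (h : Lab G w d S) (hd : d ≤ d') : Lab G w d' S := by
  induction d', hd using Nat.le_induction with
  | base => exact h
  | succ n _ ih => exact ih.up

lemma Lab.insertV {w d : ℕ} {S : Set V} (h : Lab G w d S) (r : V) :
    Lab G (w + 1) d (insert r S) := by
  cases d with
  | zero => exact (Set.ncard_insert_le r S).trans (Nat.succ_le_succ h)
  | succ d =>
    obtain ⟨X, hX, hw, h⟩ := h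
    refine ⟨insert r X, Set.insert_subset_insert hX,
      (Set.ncard_insert_le r X).trans (Nat.succ_le_succ hw), ?_⟩
    intro C hC hcon
    refine (h C ?_ hcon).mono_w (Nat.le_succ w)
    intro y hy
    obtain ⟨h1, h2⟩ := hC hy
    rw [Set.mem_insert_iff, not_or] at h2
    exact ⟨h1.resolve_left h2.1, h2.2⟩

/-- `C` is a connected component of `G[U]`. -/
def IsComp (G : SimpleGraph V) (U C : Set V) : Prop :=
  ConnSet G C ∧ C ⊆ U ∧ ∀ D ⊆ U, ConnSet G D → (C ∩ D).Nonempty → D ⊆ C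

lemma exists_comp {U D : Set V} (hD : ConnSet G D) (hDU : D ⊆ U) :
    ∃ C, IsComp G U C ∧ D ⊆ C := by
  obtain ⟨v, hv⟩ := hD.nonempty'
  have hDC : D ⊆ {y | ∃ C ⊆ U, ConnSet G C ∧ v ∈ C ∧ y ∈ C} :=
    fun y hy => ⟨D, hDU, hD, hv, hy⟩
  refine ⟨{y | ∃ C ⊆ U, ConnSet G C ∧ v ∈ C ∧ y ∈ C}, ⟨?_, ?_, ?_⟩, hDC⟩
  · refine connSet_of_root v (hDC hv) ?_
    rintro P hP hPv y ⟨C, hCU, hC, hvC, hyC⟩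
    exact hC.ind P (fun a ha b hb hab => hP a ⟨C, hCU, hC, hvC, ha⟩ b ⟨C, hCU, hC, hvC, hb⟩ hab)
      hvC hyC hPv
  · rintro y ⟨C, hCU, _, _, hy⟩
    exact hCU hy
  · rintro E hEU hE ⟨z, ⟨C, hCU, hC, hvC, hzC⟩, hzE⟩ y hy
    refine ⟨C ∪ E, Set.union_subset hCU hEU, ?_, Or.inl hvC, Or.inr hy⟩
    refine connSet_of_root z (Or.inl hzC) ?_
    rintro P hP hPz b (hb | hb)
    · exact hC.ind P (fun a ha b hb hab => hP a (Or.inl ha) b (Or.inl hb) hab) hzC hb hPz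
    · exact hE.ind P (fun a ha b hb hab => hP a (Or.inr ha) b (Or.inr hb) hab) hzE hb hPz

lemma comp_disjoint {U C D : Set V} (hC : IsComp G U C) (hD : IsComp G U D) (h : C ≠ D) :
    Disjoint C D := by
  rw [Set.disjoint_iff_inter_eq_empty]
  by_contra hne
  have hne := Set.nonempty_iff_ne_empty.2 hne
  exact h (Set.Subset.antisymm (hD.2.2 C hC.2.1 hC.1 (by rwa [Set.inter_comm]))
    (hC.2.2 D hD.2.1 hD.1 hne))

lemma step {k w : ℕ} (hk : 1 ≤ k) (U : Set V) (Q : V → Prop)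
    (hyp : ∀ C, IsComp G U C → ∃ x, Q x ∧ ∃ ρ, RM G k ρ C x ∧ Lab G w ρ C) :
    ∃ m, (∀ C ⊆ U, ConnSet G C → Lab G w m C) ∧
      (m = 0 ∨ ∃ C ⊆ U, ∃ x, Q x ∧ RM G k m C x) ∧
      ((∃ (A : Fin k → Set V) (x : Fin k → V), (∀ i, A i ⊆ U) ∧
        (∀ i j, i ≠ j → Disjoint (A i) (A j)) ∧ ∀ i, Q (x i) ∧ RM G k m (A i) (x i)) ∨
        Lab G (k * w) m U) := by
  classical
  have hww : w ≤ k * w := Nat.le_mul_of_pos_left w hk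
  choose! x hQ ρ hRM hLab using hyp
  let 𝒞 : Finset (Set V) := (Set.toFinite {C | IsComp G U C}).toFinset
  have h𝒞 : ∀ C, C ∈ 𝒞 ↔ IsComp G U C := by intro C; simp [𝒞]
  have hle : ∀ C, IsComp G U C → ρ C ≤ 𝒞.sup ρ := fun C hC => Finset.le_sup ((h𝒞 C).2 hC)
  refine ⟨𝒞.sup ρ, ?_, ?_, ?_⟩
  · intro D hDU hD
    obtain ⟨C, hC, hDC⟩ := exists_comp hD hDU
    exact ((hLab C hC).le (hle C hC)).mono hDC
  · rcases 𝒞.eq_empty_or_nonempty with he | hne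
    · left; rw [he]; rfl
    · right
      obtain ⟨C, hC, hm⟩ := Finset.exists_mem_eq_sup 𝒞 hne ρ
      have hC' := (h𝒞 C).1 hC
      refine ⟨C, hC'.2.1, x C hC', hQ C hC', ?_⟩
      rw [hm]; exact hRM C hC'
  · by_cases hcard : k ≤ (𝒞.filter (fun C => ρ C = 𝒞.sup ρ)).card
    · left
      let 𝒟 := 𝒞.filter (fun C => ρ C = 𝒞.sup ρ)
      let e : Fin k → Set V := fun i => (𝒟.equivFin.symm (Fin.castLE hcard i)).1
      have he : ∀ i, e i ∈ 𝒟 := fun i => (𝒟.equivFin.symm (Fin.castLE hcard i)).2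
      have hinj : Function.Injective e := by
        intro i j hij
        exact Fin.castLE_injective hcard (𝒟.equivFin.symm.injective (Subtype.ext hij))
      have hec : ∀ i, IsComp G U (e i) := fun i => (h𝒞 _).1 (Finset.mem_filter.1 (he i)).1
      refine ⟨e, fun i => x (e i) (hec i), fun i => (hec i).2.1,
        fun i j hij => comp_disjoint (hec i) (hec j) (fun h => hij (hinj h)), fun i =>
        ⟨hQ _ (hec i), ?_⟩⟩
      have := hRM _ (hec i)
      rwa [(Finset.mem_filter.1 (he i)).2] at this
    · right
      have hcard : (𝒞.filter (fun C => ρ C = 𝒞.sup ρ)).card ≤ k := by omega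
      generalize hm : 𝒞.sup ρ = m at *
      cases m with
      | zero =>
        have hsub : U ⊆ ⋃ C ∈ 𝒞, C := by
          intro v hv
          obtain ⟨C, hC, hvC⟩ := exists_comp (connSet_singleton G v) (Set.singleton_subset_iff.2 hv)
          simp only [Set.mem_iUnion]
          exact ⟨C, (h𝒞 C).2 hC, hvC rfl⟩
        show U.ncard ≤ k * w
        refine (Set.ncard_le_ncard hsub (Set.toFinite _)).trans ?_
        refine (Finset.set_ncard_biUnion_le _ _).trans ?_
        refine (Finset.sum_le_card_nsmul _ _ w ?_).trans ?_
        · intro C hC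
          have h1 := hLab C ((h𝒞 C).1 hC)
          have h2 := hle C ((h𝒞 C).1 hC)
          rw [Nat.le_zero.1 h2] at h1
          exact h1
        · rw [smul_eq_mul]
          refine Nat.mul_le_mul_right _ (le_trans ?_ hcard)
          refine Finset.card_le_card ?_
          intro C hC
          exact Finset.mem_filter.2 ⟨hC, Nat.le_zero.1 (hle C ((h𝒞 C).1 hC))⟩
      | succ m =>
        have hX : ∀ C ∈ 𝒞.filter (fun C => ρ C = m + 1), ∃ X ⊆ C, X.ncard ≤ w ∧
            ∀ D ⊆ C \ X, ConnSet G D → Lab G w m D := by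
          intro C hC
          obtain ⟨h1, h2⟩ := Finset.mem_filter.1 hC
          have := hLab C ((h𝒞 C).1 h1)
          rw [h2] at this
          exact this
        choose! X hXC hXw hXL using hX
        refine ⟨⋃ C ∈ 𝒞.filter (fun C => ρ C = m + 1), X C, ?_, ?_, ?_⟩
        · refine Set.iUnion₂_subset ?_
          intro C hC
          exact (hXC C hC).trans ((h𝒞 C).1 (Finset.mem_filter.1 hC).1).2.1
        · refine (Finset.set_ncard_biUnion_le _ _).trans ?_
          refine (Finset.sum_le_card_nsmul _ _ w hXw).trans ?_
          rw [smul_eq_mul]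
          exact Nat.mul_le_mul_right _ hcard
        · intro D hDU hD
          obtain ⟨C, hC, hDC⟩ := exists_comp hD (hDU.trans Set.sdiff_subset)
          refine Lab.mono_w hww ?_
          by_cases hCm : ρ C = m + 1
          · have hC𝒟 : C ∈ 𝒞.filter (fun C => ρ C = m + 1) := Finset.mem_filter.2 ⟨(h𝒞 C).2 hC, hCm⟩
            refine hXL C hC𝒟 D ?_ hD
            intro y hy
            refine ⟨hDC hy, fun hyX => (hDU hy).2 ?_⟩
            simp only [Set.mem_iUnion]
            exact ⟨C, hC𝒟, hyX⟩
          · have := hle C hC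
            exact ((hLab C hC).le (by omega)).mono hDC

/-- bound on the separators -/
def Wb (k : ℕ) : ℕ → ℕ
  | 0 => 0
  | L + 1 => k * Wb k L + 1

lemma core {k : ℕ} (hk : 1 ≤ k) : ∀ (L : ℕ) (S : Set V) (r : V), ConnSet G S → r ∈ S →
    (∀ l : List V, (r :: l).IsChain G.Adj → (r :: l).Nodup → (∀ x ∈ l, x ∈ S) →
      (r :: l).length ≤ L) → ∃ ρ, RM G k ρ S r ∧ Lab G (Wb k L) ρ S := by
  intro L
  induction L with
  | zero =>
    intro S r _ _ h
    have := h [] (by simp) (by simp) (by simp)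
    simp at this
  | succ L ih =>
    intro S r hS hr hL
    obtain ⟨m, h1, h2, h3⟩ := step (G := G) (w := Wb k L) hk (S \ {r}) (fun x => G.Adj r x) (by
      intro C hC
      have hrC : r ∉ C := fun h => (hC.2.1 h).2 rfl
      have : ∃ x ∈ C, G.Adj r x := by
        by_contra hno
        push Not at hno
        obtain ⟨c, hc⟩ := hC.1.nonempty'
        refine hrC (hS.ind (fun y => y ∈ C) ?_ (hC.2.1 hc).1 hr hc)
        intro a ha b hb hab haC
        have hbr : b ≠ r := by
          rintro rfl
          exact hno a haC hab.symm
        refine hC.2.2 (insert b C) ?_ (connSet_insert hC.1 haC hab.symm) ⟨a, haC, Or.inr haC⟩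
          (Or.inl rfl)
        rintro y (rfl | hy)
        · exact ⟨hb, hbr⟩
        · exact hC.2.1 hy
      obtain ⟨x, hxC, hx⟩ := this
      refine ⟨x, hx, ?_⟩
      refine ih C x hC.1 hxC ?_
      intro l hl1 hl2 hl3
      have := hL (x :: l) (by rw [List.isChain_cons_cons]; exact ⟨hx, hl1⟩) (by
        rw [List.nodup_cons]
        refine ⟨?_, hl2⟩
        intro hmem
        rcases List.mem_cons.1 hmem with rfl | hmem
        · exact hrC hxC
        · exact hrC (hl3 _ hmem)) (by
        intro y hy
        rcases List.mem_cons.1 hy with rfl | hy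
        · exact (hC.2.1 hxC).1
        · exact (hC.2.1 (hl3 _ hy)).1)
      simpa using this)
    have hins : insert r (S \ {r}) = S := by
      rw [Set.insert_sdiff_singleton, Set.insert_eq_of_mem hr]
    have hWW : Wb k L ≤ Wb k (L + 1) := by
      show Wb k L ≤ k * Wb k L + 1
      have := Nat.le_mul_of_pos_left (Wb k L) hk
      omega
    rcases h3 with ⟨A, x, hA, hdis, hQ⟩ | h3
    · refine ⟨m + 1, ?_, ?_⟩
      · refine ⟨{r}, Set.singleton_subset_iff.2 hr, connSet_singleton G r, rfl, A, x,
          fun i => (hA i).trans Set.sdiff_subset, ?_, hdis, fun i => ⟨r, rfl, (hQ i).1⟩,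
          fun i => (hQ i).2⟩
        intro i
        rw [Set.disjoint_singleton_left]
        exact fun h => (hA i h).2 rfl
      · refine ⟨{r}, Set.singleton_subset_iff.2 hr, ?_, ?_⟩
        · rw [Set.ncard_singleton]; exact Nat.succ_le_succ (Nat.zero_le _)
        · intro C hC hcon
          exact (h1 C hC hcon).mono_w hWW
    · refine ⟨m, ?_, ?_⟩
      · rcases h2 with rfl | ⟨C, hC, x, hx, hRM⟩
        · exact hr
        · refine (hRM.extend (r' := r) (fun h => (hC h).2 rfl) hx).mono ?_
          rw [← hins]
          exact Set.insert_subset_insert hC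
      · have := h3.insertV r
        rw [hins] at this
        exact this

end Core
section Final

variable {V : Type} {G : SimpleGraph V}

/-- `k` disjoint rooted tree minors. -/
def DRM (G : SimpleGraph V) (k d : ℕ) : Prop :=
  ∃ (A : Fin k → Set V) (x : Fin k → V), (∀ i j, i ≠ j → Disjoint (A i) (A j)) ∧
    ∀ i, RM G k d (A i) (x i)

lemma RM.map {k : ℕ} : ∀ {ρ : ℕ} {S : Set V} {r : V}, RM G k ρ S r →
    ∃ ν : List (Fin k) → Set V, r ∈ ν [] ∧
      (∀ l, l.length ≤ ρ → ConnSet G (ν l) ∧ ν l ⊆ S) ∧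
      (∀ l l', l.length ≤ ρ → l'.length ≤ ρ → l ≠ l' → Disjoint (ν l) (ν l')) ∧
      (∀ l i, l.length + 1 ≤ ρ → ∃ g ∈ ν l, ∃ g' ∈ ν (l ++ [i]), G.Adj g g') := by
  intro ρ
  induction ρ with
  | zero =>
    intro S r h
    refine ⟨fun _ => {r}, rfl, ?_, ?_, ?_⟩
    · intro l _
      exact ⟨connSet_singleton G r, Set.singleton_subset_iff.2 h⟩
    · intro l l' hl hl' hne
      exact absurd ((List.length_eq_zero_iff.1 (Nat.le_zero.1 hl)).trans
        (List.length_eq_zero_iff.1 (Nat.le_zero.1 hl')).symm) hne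
    · intro l i hl; omega
  | succ ρ ih =>
    rintro S r ⟨X, hX, hc, hr, A, x, h1, h2, h3, h4, h5⟩
    choose ν n1 n2 n3 n4 using fun i => ih (h5 i)
    refine ⟨fun l => match l with | [] => X | i :: t => ν i t, hr, ?_, ?_, ?_⟩
    · intro l hl
      cases l with
      | nil => exact ⟨hc, hX⟩
      | cons i t =>
        have := n2 i t (by simpa using hl)
        exact ⟨this.1, this.2.trans (h1 i)⟩
    · intro l l' hl hl' hne
      cases l with
      | nil =>
        cases l' with
        | nil => exact absurd rfl hne
        | cons j t' => exact (h2 j).mono_right (n2 j t' (by simpa using hl')).2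
      | cons i t =>
        cases l' with
        | nil => exact ((h2 i).mono_right (n2 i t (by simpa using hl)).2).symm
        | cons j t' =>
          by_cases hij : i = j
          · subst hij
            exact n3 i t t' (by simpa using hl) (by simpa using hl') (fun e => hne (by rw [e]))
          · exact ((h3 i j hij).mono_right (n2 j t' (by simpa using hl')).2).mono_left
              (n2 i t (by simpa using hl)).2
    · intro l i hl
      cases l with
      | nil =>
        obtain ⟨y, hy, hyx⟩ := h4 i
        exact ⟨y, hy, x i, n1 i, hyx⟩
      | cons j t => exact n4 j t i (by simpa using hl)

lemma DRM.map {k d : ℕ} (h : DRM G k d) :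
    ∃ ν : List (Fin k) → Set V,
      (∀ l, l ≠ [] → l.length ≤ d + 1 → ConnSet G (ν l)) ∧
      (∀ l l', l ≠ [] → l' ≠ [] → l.length ≤ d + 1 → l'.length ≤ d + 1 → l ≠ l' →
        Disjoint (ν l) (ν l')) ∧
      (∀ l i, l ≠ [] → l.length + 1 ≤ d + 1 → ∃ g ∈ ν l, ∃ g' ∈ ν (l ++ [i]), G.Adj g g') := by
  obtain ⟨A, x, h3, h5⟩ := h
  choose ν n1 n2 n3 n4 using fun i => (h5 i).map
  refine ⟨fun l => match l with | [] => ∅ | i :: t => ν i t, ?_, ?_, ?_⟩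
  · intro l hne hl
    cases l with
    | nil => exact absurd rfl hne
    | cons i t => exact (n2 i t (by simpa using hl)).1
  · intro l l' hl0 hl0' hl hl' hne
    cases l with
    | nil => exact absurd rfl hl0
    | cons i t =>
      cases l' with
      | nil => exact absurd rfl hl0'
      | cons j t' =>
        by_cases hij : i = j
        · subst hij
          exact n3 i t t' (by simpa using hl) (by simpa using hl') (fun e => hne (by rw [e]))
        · exact ((h3 i j hij).mono_right (n2 j t' (by simpa using hl')).2).mono_left
            (n2 i t (by simpa using hl)).2
  · intro l i hl0 hl
    cases l with
    | nil => exact absurd rfl hl0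
    | cons j t => exact n4 j t i (by simpa using hl)

lemma RM.minor {k ρ : ℕ} {S : Set V} {r : V} (h : RM G k ρ S r) :
    ∃ μ : {l : List (Fin k) // l.length ≤ ρ} → Set V, IsMinorMap (kAryTree ρ k) G μ := by
  obtain ⟨ν, _, h2, h3, h4⟩ := h.map
  refine ⟨fun l => ν l.1.reverse, ?_, ?_, ?_⟩
  · intro l
    exact (h2 _ (by simpa using l.2)).1
  · intro l l' hne
    refine h3 _ _ (by simpa using l.2) (by simpa using l'.2) ?_
    intro e
    exact hne (Subtype.ext (List.reverse_injective e))
  · intro l l' hadj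
    rcases (kAry_adj _ _).1 hadj with ⟨i, hi⟩ | ⟨i, hi⟩
    · have h5 := h4 l.1.reverse i (by have := l'.2; rw [hi] at this; simpa using this)
      beta_reduce
      rw [hi, List.reverse_cons]
      exact h5
    · obtain ⟨g, hg, g', hg', hgg⟩ := h4 l'.1.reverse i (by
        have := l.2; rw [hi] at this; simpa using this)
      beta_reduce
      rw [hi, List.reverse_cons]
      exact ⟨g', hg', g, hg, hgg.symm⟩

lemma DRM.forest_minor {d : ℕ} {F : FinGraph} (hF : F ∈ classFd d) (h : DRM G F.n d) :
    ∃ μ : Fin F.n → Set V, IsMinorMap F.G G μ := by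
  obtain ⟨ν, h2, h3, h4⟩ := h.map
  obtain ⟨f, hf, hne, hlen, hadj⟩ := forest_embed hF
  refine ⟨fun v => ν (f v).reverse, ?_, ?_, ?_⟩
  · intro v
    exact h2 _ (by simpa using hne v) (by simpa using hlen v)
  · intro v v' hvv
    refine h3 _ _ (by simpa using hne v) (by simpa using hne v') (by simpa using hlen v)
      (by simpa using hlen v') ?_
    intro e
    exact hvv (hf (List.reverse_injective e))
  · intro u v huv
    rcases hadj u v huv with ⟨i, hi⟩ | ⟨i, hi⟩
    · have h5 := h4 (f u).reverse i (by simpa using hne u)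
        (by have := hlen v; rw [hi] at this; simpa using this)
      beta_reduce
      rw [hi, List.reverse_cons]
      exact h5
    · obtain ⟨g, hg, g', hg', hgg⟩ := h4 (f v).reverse i (by simpa using hne v)
        (by have := hlen u; rw [hi] at this; simpa using this)
      beta_reduce
      rw [hi, List.reverse_cons]
      exact ⟨g', hg', g, hg, hgg.symm⟩

lemma DRM.le_k {k K d : ℕ} (hk : k ≤ K) (h : DRM G K d) : DRM G k d := by
  obtain ⟨A, x, h3, h5⟩ := h
  exact ⟨fun i => A (Fin.castLE hk i), fun i => x (Fin.castLE hk i),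
    fun i j hij => h3 _ _ (fun e => hij (Fin.castLE_injective hk e)), fun i => (h5 _).le_k hk⟩

/-- labellings by strings -/
def IsLabelling (G : SimpleGraph V) (w : ℕ) (S : Set V) (f : V → List V) : Prop :=
  (∀ l, {v | v ∈ S ∧ f v = l}.ncard ≤ w) ∧
    ∀ u ∈ S, ∀ v ∈ S, G.Adj u v → f u <:+ f v ∨ f v <:+ f u

variable [Finite V]

lemma labF {w d : ℕ}
    (ha : ∀ S : Set V, Lab G w d S → ∃ f, (∀ v ∈ S, (f v).length ≤ d) ∧ IsLabelling G w S f)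
    (S : Set V) (hS : ∀ C ⊆ S, ConnSet G C → Lab G w d C) :
    ∃ f, (∀ v ∈ S, f v ≠ [] ∧ (f v).length ≤ d + 1) ∧ IsLabelling G w S f := by
  have hcomp : ∀ C, IsComp G S C → ∃ f, (∀ v ∈ C, (f v).length ≤ d) ∧ IsLabelling G w C f :=
    fun C hC => ha C (hS C hC.2.1 hC.1)
  choose! F hF1 hF2 using hcomp
  have hc : ∀ v, v ∈ S → ∃ C, IsComp G S C ∧ v ∈ C := by
    intro v hv
    obtain ⟨C, hC, hvC⟩ := exists_comp (connSet_singleton G v) (Set.singleton_subset_iff.2 hv)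
    exact ⟨C, hC, hvC rfl⟩
  choose! c hc1 hc2 using hc
  have hrep : ∀ v, v ∈ S → ∃ r, r ∈ c v := fun v hv => (hc1 v hv).1.nonempty'
  -- a representative depending only on the component
  have hrp : ∃ rp : Set V → V → V, ∀ C v, v ∈ C → rp C v ∈ C ∧ ∀ v' ∈ C, rp C v = rp C v' := by
    classical
    refine ⟨fun C v => if h : C.Nonempty then h.some else v, ?_⟩
    intro C v hv
    have h : C.Nonempty := ⟨v, hv⟩
    simp only [h, dif_pos]
    exact ⟨h.some_mem, fun _ _ => trivial⟩
  obtain ⟨rp, hrp⟩ := hrp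
  have hceq : ∀ u v, u ∈ S → v ∈ S → (c u ∩ c v).Nonempty → c u = c v := by
    intro u v hu hv hne
    by_contra hh
    have := comp_disjoint (hc1 u hu) (hc1 v hv) hh
    rw [Set.disjoint_iff_inter_eq_empty] at this
    rw [this] at hne
    exact Set.not_nonempty_empty hne
  refine ⟨fun v => F (c v) v ++ [rp (c v) v], ?_, ?_, ?_⟩
  · intro v hv
    refine ⟨by simp, ?_⟩
    have := hF1 (c v) (hc1 v hv) v (hc2 v hv)
    simpa using this
  · intro l
    rcases Set.eq_empty_or_nonempty {v | v ∈ S ∧ F (c v) v ++ [rp (c v) v] = l} with he | ⟨v0, hv0, e0⟩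
    · rw [he]; simp
    · refine le_trans (Set.ncard_le_ncard ?_ (Set.toFinite _))
        ((hF2 (c v0) (hc1 v0 hv0)).1 (F (c v0) v0))
      rintro v ⟨hv, e⟩
      rw [← e0] at e
      obtain ⟨e1, e2⟩ := List.append_inj' e rfl
      have e3 : rp (c v) v = rp (c v0) v0 := by simpa using e2
      have e4 : c v = c v0 := by
        refine hceq v v0 hv hv0 ⟨rp (c v) v, (hrp _ _ (hc2 v hv)).1, ?_⟩
        rw [e3]; exact (hrp _ _ (hc2 v0 hv0)).1
      rw [e4] at e1
      refine ⟨?_, e1⟩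
      rw [← e4]; exact hc2 v hv
  · intro u hu v hv huv
    have e : c u = c v := by
      refine hceq u v hu hv ⟨v, ?_, hc2 v hv⟩
      have hcon : ConnSet G (insert v {u}) := connSet_insert (connSet_singleton G u) rfl huv.symm
      refine (hc1 u hu).2.2 _ ?_ hcon ⟨u, hc2 u hu, Or.inr rfl⟩ (Or.inl rfl)
      rintro y (rfl | rfl)
      · exact hv
      · exact hu
    have hu' : u ∈ c v := e ▸ hc2 u hu
    have er : rp (c v) u = rp (c v) v := (hrp _ _ hu').2 v (hc2 v hv)
    show F (c u) u ++ [rp (c u) u] <:+ F (c v) v ++ [rp (c v) v] ∨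
      F (c v) v ++ [rp (c v) v] <:+ F (c u) u ++ [rp (c u) u]
    rw [e, er]
    have key : ∀ (a b : List V) (z : V), a <:+ b → a ++ [z] <:+ b ++ [z] := by
      rintro a b z ⟨t, rfl⟩
      exact ⟨t, by simp⟩
    rcases (hF2 (c v) (hc1 v hv)).2 u hu' v (hc2 v hv) huv with h | h
    · exact Or.inl (key _ _ _ h)
    · exact Or.inr (key _ _ _ h)

lemma labT {w : ℕ} : ∀ (d : ℕ) (S : Set V), Lab G w d S →
    ∃ f, (∀ v ∈ S, (f v).length ≤ d) ∧ IsLabelling G w S f := by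
  intro d
  induction d with
  | zero =>
    intro S hS
    refine ⟨fun _ => [], fun _ _ => le_refl _, ?_, fun _ _ _ _ _ => Or.inl (List.suffix_refl _)⟩
    intro l
    exact (Set.ncard_le_ncard (fun v hv => hv.1) (Set.toFinite _)).trans hS
  | succ d ih =>
    rintro S ⟨X, hX, hw, hC⟩
    classical
    obtain ⟨f, hf1, hf2, hf3⟩ := labF ih (S \ X) hC
    refine ⟨fun v => if v ∈ X then [] else f v, ?_, ?_, ?_⟩
    · intro v hv
      by_cases hvX : v ∈ X
      · simp [hvX]
      · simpa [hvX] using (hf1 v ⟨hv, hvX⟩).2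
    · intro l
      cases l with
      | nil =>
        refine (Set.ncard_le_ncard ?_ (Set.toFinite _)).trans hw
        rintro v ⟨hv, e⟩
        by_contra hvX
        simp only [hvX, if_false] at e
        exact (hf1 v ⟨hv, hvX⟩).1 e
      | cons a l =>
        refine (Set.ncard_le_ncard ?_ (Set.toFinite _)).trans (hf2 (a :: l))
        rintro v ⟨hv, e⟩
        by_cases hvX : v ∈ X
        · simp [hvX] at e
        · simp only [hvX, if_false] at e
          exact ⟨⟨hv, hvX⟩, e⟩
    · intro u hu v hv huv
      by_cases huX : u ∈ X
      · left; simp [huX]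
      · by_cases hvX : v ∈ X
        · right; simp [hvX]
        · simp only [huX, hvX, if_false]
          exact hf3 u ⟨hu, huX⟩ v ⟨hv, hvX⟩ huv

/-- A labelling yields a deconstruction into a graph of strings. -/
lemma labelling_decon {β : Type} {w D : ℕ} {f : V → List V} (hf : IsLabelling G w Set.univ f)
    (H : SimpleGraph β) (c : β → List V) (hc : Function.Injective c)
    (hD : ∀ b, (c b).length ≤ D) (hadj : ∀ a b i, c b = i :: c a → H.Adj a b)
    (hfc : ∀ v, ∃ b, c b = f v) (hcl : ∀ b i t v, c b = i :: (t ++ f v) → ∃ a, c a = t ++ f v) :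
    IsDeconstruction G H (fun b => {v | f v <:+ c b}) ∧
      DeconWidthLE H (fun b => {v | f v <:+ c b}) ((D + 1) * w + (D + 1) * w) := by
  refine ⟨⟨?_, ?_⟩, ?_⟩
  · intro u v huv
    have : f u <:+ f v ∨ f v <:+ f u := by
      rcases huv with rfl | huv
      · exact Or.inl (List.suffix_refl _)
      · exact hf.2 u trivial v trivial huv
    rcases this with h | h
    · obtain ⟨b, hb⟩ := hfc v
      refine ⟨b, b, Or.inl rfl, Or.inl ?_, Or.inl ?_⟩
      · show f u <:+ c b; rw [hb]; exact h
      · show f v <:+ c b; rw [hb]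
    · obtain ⟨b, hb⟩ := hfc u
      refine ⟨b, b, Or.inl rfl, Or.inl ?_, Or.inl ?_⟩
      · show f u <:+ c b; rw [hb]
      · show f v <:+ c b; rw [hb]; exact h
  · intro v
    obtain ⟨b0, hb0⟩ := hfc v
    refine connSet_of_root b0 (by show f v <:+ c b0; rw [hb0]) ?_
    intro P hP hP0 b hb
    obtain ⟨t, ht⟩ := hb
    induction t generalizing b with
    | nil =>
      have : b = b0 := hc (by rw [hb0, ← ht]; rfl)
      rw [this]; exact hP0
    | cons i t ih =>
      obtain ⟨a, ha⟩ := hcl b i t v ht.symm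
      have hPa := ih a ha.symm
      refine hP a ⟨t, ha.symm⟩ b ⟨i :: t, ht⟩ (hadj a b i ?_) hPa
      rw [ha, ← ht]; rfl
  · have one : ∀ b, {v | f v <:+ c b}.ncard ≤ (D + 1) * w := by
      intro b
      have hsub : {v | f v <:+ c b} ⊆ ⋃ m ∈ Finset.range (D + 1), {v | v ∈ Set.univ ∧ f v = suf m (c b)} := by
        intro v hv
        simp only [Set.mem_iUnion]
        refine ⟨(f v).length, ?_, trivial, ?_⟩
        · rw [Finset.mem_range]
          exact Nat.lt_succ_of_le (le_trans (List.IsSuffix.length_le hv) (hD b))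
        · exact List.suffix_iff_eq_drop.1 hv
      refine (Set.ncard_le_ncard hsub (Set.toFinite _)).trans ?_
      refine (Finset.set_ncard_biUnion_le _ _).trans ?_
      refine (Finset.sum_le_card_nsmul _ _ w (fun m _ => hf.1 _)).trans ?_
      simp
    intro a b _
    exact (Set.ncard_union_le _ _).trans (Nat.add_le_add (one a) (one b))

end Final

lemma lab_Td {w d : ℕ} (G : FinGraph) (h : Lab G.G w d Set.univ) :
    ∃ H ∈ classTd d, ∃ B : Fin H.n → Set (Fin G.n),
      IsDeconstruction G.G H.G B ∧ DeconWidthLE H.G B ((d + 1) * w + (d + 1) * w) := by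
  obtain ⟨f, hf1, hf2⟩ := labT d _ h
  obtain ⟨M, ⟨e⟩⟩ := exists_finGraph (kAryTree d G.n)
  obtain ⟨h1, h2⟩ := labelling_decon hf2 (kAryTree d G.n) Subtype.val Subtype.val_injective
    (fun b => b.2) (fun a b i hi => (kAry_adj a b).2 (Or.inl ⟨i, hi⟩))
    (fun v => ⟨⟨f v, hf1 v trivial⟩, rfl⟩)
    (fun b i t v hb => ⟨⟨t ++ f v, by have := b.2; rw [hb] at this; simp at this ⊢; omega⟩, rfl⟩)
  exact ⟨M, kAry_mem_classTd e, _, decon_iso_right e h1 h2⟩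

lemma lab_Fd {w d : ℕ} (G : FinGraph) (h : ∀ C, ConnSet G.G C → Lab G.G w d C) :
    ∃ H ∈ classFd d, ∃ B : Fin H.n → Set (Fin G.n),
      IsDeconstruction G.G H.G B ∧
        DeconWidthLE H.G B ((d + 1 + 1) * w + (d + 1 + 1) * w) := by
  obtain ⟨f, hf1, hf2⟩ := labF (labT d) Set.univ (fun C _ => h C)
  obtain ⟨M, ⟨e⟩⟩ := exists_finGraph (kAryForest d G.n)
  obtain ⟨h1, h2⟩ := labelling_decon hf2 (kAryForest d G.n) (fun b => b.1.1)
    (fun a b hab => Subtype.ext (Subtype.ext hab))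
    (fun b => b.1.2) (fun a b i hi => (kAry_adj a.1 b.1).2 (Or.inl ⟨i, hi⟩))
    (fun v => ⟨⟨⟨f v, (hf1 v trivial).2⟩, (hf1 v trivial).1⟩, rfl⟩)
    (fun b i t v hb => ⟨⟨⟨t ++ f v, by have := b.1.2; rw [hb] at this; simp at this ⊢; omega⟩, by
      have := (hf1 v trivial).1
      simp [this]⟩, rfl⟩)
  exact ⟨M, kAryForest_mem_classFd e, _, decon_iso_right e h1 h2⟩

/-- The structure theorem for a single graph of bounded tree depth. -/
lemma structure_graph {h k d : ℕ} (hk : 1 ≤ k) (G : FinGraph) (hG : TreeDepthLE G.G h)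
    (hno : ∀ S r, ¬ RM G.G k (d + 1) S r) :
    (∀ C, ConnSet G.G C → Lab G.G (Wb k (2 ^ (h + 1))) d C) ∧
      (DRM G.G k d ∨ Lab G.G (k * Wb k (2 ^ (h + 1))) d Set.univ) := by
  obtain ⟨m, h1, h2, h3⟩ := step (G := G.G) (w := Wb k (2 ^ (h + 1))) hk Set.univ (fun _ => True) (by
    intro C hC
    obtain ⟨r, hr⟩ := hC.1.nonempty'
    exact ⟨r, trivial, core hk _ C r hC.1 hr (fun l hl1 hl2 _ => path_bound hG _ hl1 hl2)⟩)
  have hmd : m ≤ d := by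
    by_contra hlt
    rcases h2 with rfl | ⟨C, _, x, _, hRM⟩
    · omega
    · exact hno C x (hRM.le (by omega))
  refine ⟨fun C hC => (h1 C (Set.subset_univ _) hC).le hmd, ?_⟩
  rcases h3 with ⟨A, x, _, hdis, hQ⟩ | h3
  · rcases hmd.lt_or_eq with hlt | rfl
    · right
      have : Lab G.G (Wb k (2 ^ (h + 1))) (m + 1) Set.univ :=
        ⟨∅, Set.empty_subset _, by simp, fun C _ hC => h1 C (Set.subset_univ _) hC⟩
      exact (this.le hlt).mono_w (Nat.le_mul_of_pos_left _ hk)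
    · exact Or.inl ⟨A, x, hdis, fun i => (hQ i).2⟩
  · exact Or.inr (h3.le hmd)

lemma not_stack_bound {𝒢 : Set FinGraph} {d : ℕ} (h : ¬ StackAll 𝒢 d) :
    ∃ k, 1 ≤ k ∧ ∀ K, k ≤ K → ∀ G ∈ 𝒢, ∀ S r, ¬ RM G.G K d S r := by
  unfold StackAll at h
  push Not at h
  obtain ⟨k, hk, hno⟩ := h
  refine ⟨k, hk, fun K hK G hG S r hRM => ?_⟩
  obtain ⟨μ, hμ⟩ := (hRM.le_k hK).minor
  exact hno G hG μ hμ

lemma le_Fd {𝒢 : Set FinGraph} {d : ℕ} (hb : HasBoundedTreeDepth 𝒢) (h : ¬ StackAll 𝒢 (d + 1)) :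
    DeconLE 𝒢 (classFd d) := by
  obtain ⟨t, ht⟩ := hb
  obtain ⟨k, hk, hno⟩ := not_stack_bound h
  refine ⟨_, fun G hG => lab_Fd G (structure_graph hk G (ht G hG) (hno k le_rfl G hG)).1⟩

lemma le_Td {𝒢 : Set FinGraph} {d k0 : ℕ} (hb : HasBoundedTreeDepth 𝒢)
    (h : ¬ StackAll 𝒢 (d + 1)) (h0 : ∀ G ∈ 𝒢, ¬ DRM G.G k0 d) : DeconLE 𝒢 (classTd d) := by
  obtain ⟨t, ht⟩ := hb
  obtain ⟨k, hk, hno⟩ := not_stack_bound h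
  refine ⟨_, fun G hG => lab_Td G ((structure_graph (k := max k k0) (le_max_of_le_left hk) G
    (ht G hG) (hno _ (le_max_left _ _) G hG)).2.resolve_left ?_)⟩
  exact fun hD => h0 G hG (hD.le_k (le_max_right _ _))

lemma Td_le {𝒢 : Set FinGraph} {d : ℕ} (h : StackAll 𝒢 d) : DeconLE (classTd d) 𝒢 := by
  refine ⟨2, fun T hT => ?_⟩
  obtain ⟨r, _⟩ := hT.2
  obtain ⟨G, hG, μ, hμ⟩ := h T.n (by have := r.2; omega)
  obtain ⟨f, hf, hlen, hadj⟩ := tree_embed hT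
  exact ⟨G, hG, _, minor_decon (minor_comp hμ (fun v => ⟨f v, hlen v⟩)
    (fun a b hab => hf (congrArg Subtype.val hab)) (fun a b hab => (kAry_adj _ _).2 (hadj a b hab)))⟩

lemma Fd_le {𝒢 : Set FinGraph} {d : ℕ} (h : ∀ k, ∃ G ∈ 𝒢, DRM G.G k d) :
    DeconLE (classFd d) 𝒢 := by
  refine ⟨2, fun F hF => ?_⟩
  obtain ⟨G, hG, hD⟩ := h F.n
  obtain ⟨μ, hμ⟩ := hD.forest_minor hF
  exact ⟨G, hG, _, minor_decon hμ⟩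

lemma stack_of_Td_le {𝒢 : Set FinGraph} {d : ℕ} (hb : HasBoundedTreeDepth 𝒢)
    (h : DeconLE (classTd d) 𝒢) : StackAll 𝒢 d := by
  cases d with
  | zero =>
    intro k hk
    obtain ⟨w, h⟩ := h
    obtain ⟨M, ⟨e⟩⟩ := exists_finGraph (kAryTree 0 k)
    obtain ⟨G, hG, B, hB, _⟩ := h M (kAry_mem_classTd e)
    obtain ⟨g, _⟩ := (hB.2 (e ⟨[], le_rfl⟩)).nonempty'
    have hRM : RM G.G k 0 {g} g := rfl
    exact ⟨G, hG, hRM.minor⟩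
  | succ d =>
    by_contra hn
    exact not_Td_le_Fd d (h.trans (le_Fd hb hn))

lemma not_stack_of_le_Fd {𝒢 : Set FinGraph} {d : ℕ} (h : DeconLE 𝒢 (classFd d)) :
    ¬ StackAll 𝒢 (d + 1) := fun hs => not_Td_le_Fd d ((Td_le hs).trans h)

/-- for a class `𝒢` of bounded tree depth and `d ≥ 0`: `𝒢` has
stack depth `d` iff `𝒢 ≡ 𝒯_d` or `𝒢 ≡ ℱ_d`. -/
theorem stack_depth_placement (𝒢 : Set FinGraph)
    (hbtd : HasBoundedTreeDepth 𝒢) (d : ℕ) :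
    HasStackDepth 𝒢 d ↔
      (DeconEquiv 𝒢 (classTd d) ∨ DeconEquiv 𝒢 (classFd d)) := by
  constructor
  · rintro ⟨h1, h2⟩
    by_cases hD : ∀ k, ∃ G ∈ 𝒢, DRM G.G k d
    · exact Or.inr ⟨le_Fd hbtd h2, Fd_le hD⟩
    · push Not at hD
      obtain ⟨k0, h0⟩ := hD
      exact Or.inl ⟨le_Td hbtd h2 h0, Td_le h1⟩
  · rintro (⟨h1, h2⟩ | ⟨h1, h2⟩)
    · exact ⟨stack_of_Td_le hbtd h2, not_stack_of_le_Fd (h1.mono_right (classTd_sub d))⟩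
    · exact ⟨stack_of_Td_le hbtd (h2.mono_left (classTd_sub d)), not_stack_of_le_Fd h1⟩
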